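/- Let rho be any integer such that F(p,rho) is non-empty. Then: m^rho_{p} = mbar if rhobar_{p} <= rho <= mbar - 2; m^rho_{p} = m_{f^rho_{p}} = rho + 1 if rho >= mbar - 1 and f^rho_{p} has regularity rho; and m^rho_{p} = m_{g^rho_{p}} = rho + 2 otherwise (i.e. if rho >= mbar - 1 and f^rho_{p} has regularity strictly less than rho). -/

import Mathlib

open scoped Classical

noncomputable section

/-! ## Binomial expansions and the Macaulay operations `(a_t)^+_+` and `(a_t)^-_-` -/

/-- The largest `k` such that `C(k,t) ≤ a` (top coefficient of the greedy binomial
expansion of `a` in base `t`). -/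
def expTop (a t : ℕ) : ℕ := Nat.findGreatest (fun k => Nat.choose k t ≤ a) (a + t + 1)

/-- `(a_t)^+_+` : if `a = C(k(t),t) + ... + C(k(j),j)` is the binomial expansion of `a`
in base `t`, then `plusPlus a t = C(k(t)+1,t+1) + ... + C(k(j)+1,j+1)`; it sends `0` to `0`. -/
def plusPlus : ℕ → ℕ → ℕ
  | _, 0 => 0
  | a, t + 1 =>
    if a = 0 then 0
    else Nat.choose (expTop a (t + 1) + 1) (t + 2) +
      plusPlus (a - Nat.choose (expTop a (t + 1)) (t + 1)) t

/-- `(a_t)^-_-` : if `a = C(k(t),t) + ... + C(k(j),j)` is the binomial expansion of `a`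
in base `t`, then `minusMinus a t = C(k(t)-1,t-1) + ... + C(k(j)-1,j-1)`; it sends `0` to `0`. -/
def minusMinus : ℕ → ℕ → ℕ
  | _, 0 => 0
  | a, t + 1 =>
    if a = 0 then 0
    else Nat.choose (expTop a (t + 1) - 1) t +
      minusMinus (a - Nat.choose (expTop a (t + 1)) (t + 1)) t

/-! ## Numerical functions -/

/-- A numerical function (modelled with values in `ℤ`) is *admissible* (an O-sequence) if it is
nonnegative, `H 0 = 1` and `H (t+1) ≤ (H(t)_t)^+_+` for every `t ≥ 1`. -/
def OSeq (H : ℕ → ℤ) : Prop :=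
  (∀ t, 0 ≤ H t) ∧ H 0 = 1 ∧ ∀ t, 1 ≤ t → H (t + 1) ≤ (plusPlus (H t).toNat t : ℤ)

/-- First derivative of a numerical function: `Δf(0) = 1`, `Δf(t) = f(t) - f(t-1)`. -/
def nderiv (f : ℕ → ℤ) : ℕ → ℤ
  | 0 => 1
  | t + 1 => f (t + 1) - f t

/-- Integral of a numerical function: `Σg(0) = 1`, `Σg(t) = Σg(t-1) + g(t)`. -/
def ninteg (g : ℕ → ℤ) : ℕ → ℤ
  | 0 => 1
  | t + 1 => ninteg g t + g (t + 1)

/-! ## Admissible Hilbert polynomials in Gotzmann form -/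

/-- The integer-valued binomial coefficient `C(a,k)` for `a : ℤ`, agreeing with the
polynomial binomial coefficient `a(a-1)⋯(a-k+1)/k!`. -/
def zchoose (a : ℤ) (k : ℕ) : ℤ :=
  if 0 ≤ a then (a.toNat.choose k : ℤ)
  else (-1) ^ k * (((k : ℤ) - 1 - a).toNat.choose k : ℤ)

/-- An admissible Hilbert polynomial, recorded through its Gotzmann form
`p(z) = C(z+k₁,k₁) + C(z+k₂-1,k₂) + ... + C(z+k_r-(r-1),k_r)` with `k₁ ≥ k₂ ≥ ... ≥ k_r ≥ 0`. -/
structure GotzmannPoly where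
  ks : List ℕ
  sorted : ks.Pairwise (· ≥ ·)

namespace GotzmannPoly

/-- The Gotzmann number `r` of `p`. -/
def r (p : GotzmannPoly) : ℕ := p.ks.length

/-- The degree of `p`, namely `k₁`. -/
def degree (p : GotzmannPoly) : ℕ := p.ks.headD 0

/-- Evaluation of `p` at an integer. -/
def eval (p : GotzmannPoly) (z : ℤ) : ℤ :=
  ∑ i ∈ Finset.range p.r, zchoose (z + (p.ks.getD i 0 : ℤ) - i) (p.ks.getD i 0)

/-- The first difference `Δp(z) = p(z) - p(z-1)`, in Gotzmann form. -/
def delta (p : GotzmannPoly) : GotzmannPoly where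
  ks := (p.ks.filter fun k => 1 ≤ k).map fun k => k - 1
  sorted := by
    refine List.Pairwise.map _ (fun {a b} h => Nat.sub_le_sub_right h 1) ?_
    exact p.sorted.filter _

/-- Iterated first difference `Δ^i p`. -/
def deltaIter (p : GotzmannPoly) (i : ℕ) : GotzmannPoly := delta^[i] p

/-- The polynomial `p(z) + c`, in Gotzmann form. -/
def addConst (p : GotzmannPoly) (c : ℕ) : GotzmannPoly where
  ks := p.ks ++ List.replicate c 0
  sorted := by
    rw [List.pairwise_append]
    refine ⟨p.sorted, ?_, ?_⟩
    · exact List.pairwise_replicate.2 (Or.inr le_rfl)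
    · intro a _ b hb
      rw [List.eq_of_mem_replicate hb]
      exact Nat.zero_le a

end GotzmannPoly

/-- The set `Π_p = {1 ≤ t ≤ r : (p(t+h)_{t+h})^+_+ ≥ p(t+h+1) ≥ 1 for all h ≥ 0}`. -/
def PiSet (p : GotzmannPoly) : Set ℕ :=
  {t | 1 ≤ t ∧ t ≤ p.r ∧ ∀ h : ℕ,
      p.eval ((t : ℤ) + (h : ℤ) + 1) ≤ (plusPlus (p.eval ((t : ℤ) + (h : ℤ))).toNat (t + h) : ℤ) ∧
      1 ≤ p.eval ((t : ℤ) + (h : ℤ) + 1)}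

/-- `ρ_p`: `0` if `min Π_p = 1` and `p(0) = 1`, and `min Π_p` otherwise. -/
def rhoP (p : GotzmannPoly) : ℕ :=
  if sInf (PiSet p) = 1 ∧ p.eval 0 = 1 then 0 else sInf (PiSet p)

/-- The minimal function `f^ρ_p` : `f(t) = p(t)` for `t ≥ ρ` and
`f(t) = ((f(t+1))_{t+1})^-_-` for `t < ρ`. -/
def fmin (p : GotzmannPoly) (ρ : ℕ) (t : ℕ) : ℤ :=
  if h : ρ ≤ t then p.eval (t : ℤ)
  else (minusMinus (fmin p ρ (t + 1)).toNat (t + 1) : ℤ)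
termination_by ρ - t
decreasing_by omega

/-- The function `g^ρ_p` : `g(t) = p(t)` for `t ≥ ρ`, `g(ρ-1) = p(ρ-1) + 1` and
`g(t) = ((g(t+1))_{t+1})^-_-` for `t < ρ-1`. -/
def gmin (p : GotzmannPoly) (ρ : ℕ) (t : ℕ) : ℤ :=
  if h : ρ ≤ t then p.eval (t : ℤ)
  else if t = ρ - 1 then p.eval (t : ℤ) + 1
  else (minusMinus (gmin p ρ (t + 1)).toNat (t + 1) : ℤ)
termination_by ρ - t
decreasing_by omega

/-- `H` has regularity `ρ` (with respect to the Hilbert polynomial `p`): `ρ` is the least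
integer such that `H(t) = p(t)` for all `t ≥ ρ`. -/
def IsRegOf (p : GotzmannPoly) (H : ℕ → ℤ) (ρ : ℕ) : Prop :=
  (∀ t : ℕ, ρ ≤ t → H t = p.eval (t : ℤ)) ∧
  ∀ ρ' : ℕ, (∀ t : ℕ, ρ' ≤ t → H t = p.eval (t : ℤ)) → ρ ≤ ρ'

/-- `H` has Hilbert polynomial `p`, i.e. eventually agrees with `p`. -/
def HasHP (p : GotzmannPoly) (H : ℕ → ℤ) : Prop :=
  ∃ N : ℕ, ∀ t : ℕ, N ≤ t → H t = p.eval (t : ℤ)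

/-- `F(p,ρ)`: the set of Hilbert functions of closed projective subschemes (i.e. numerical
functions which are admissible together with their first derivative) with Hilbert
polynomial `p` and regularity `ρ`. -/
def Fset (p : GotzmannPoly) (ρ : ℕ) : Set (ℕ → ℤ) :=
  {H | OSeq H ∧ OSeq (nderiv H) ∧ IsRegOf p H ρ}

/-- `ρ̄_p`: the minimal `ρ` such that `F(p,ρ)` is non-empty. -/
def rhobar (p : GotzmannPoly) : ℕ := sInf {ρ | (Fset p ρ).Nonempty}

/-! ## Monomial ideals in `K[x₀,…,xₙ]` (combinatorial model) -/

/-- Monomials of `K[x₀,…,xₙ]`, as exponent vectors. -/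
abbrev Mon (n : ℕ) := Fin (n + 1) → ℕ

/-- Degree of a monomial. -/
def mdeg {n : ℕ} (m : Mon n) : ℕ := ∑ i, m i

/-- `T_t`, the set of terms of degree `t`. -/
def Tset (n t : ℕ) : Set (Mon n) := {m | mdeg m = t}

/-- A set of monomials closed under multiplication by arbitrary monomials (a monomial ideal). -/
def MonIdeal {n : ℕ} (J : Set (Mon n)) : Prop :=
  ∀ m ∈ J, ∀ m' : Mon n, m + m' ∈ J

/-- The elementary Borel move sending `x^m` to `x_i · x^m / x_j`. -/
def borelStep {n : ℕ} (m : Mon n) (j i : Fin (n + 1)) : Mon n :=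
  fun l => if l = j then m l - 1 else if l = i then m l + 1 else m l

/-- One elementary Borel move `x_j ↦ x_i` with `j < i`. -/
def borelMove {n : ℕ} (a b : Mon n) : Prop :=
  ∃ j i : Fin (n + 1), j < i ∧ 1 ≤ a j ∧ b = borelStep a j i

/-- The Borel (partial) order `≤_B` on monomials. -/
def borelLE {n : ℕ} : Mon n → Mon n → Prop := Relation.ReflTransGen borelMove

/-- A strongly stable (Borel) monomial ideal. -/
def StronglyStable {n : ℕ} (J : Set (Mon n)) : Prop :=
  MonIdeal J ∧ ∀ m ∈ J, ∀ j i : Fin (n + 1), j < i → 1 ≤ m j → borelStep m j i ∈ J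

/-- A Borel set in `T_t`: a set of degree-`t` monomials closed upwards under `≤_B`. -/
def IsBorelSet {n : ℕ} (t : ℕ) (B : Set (Mon n)) : Prop :=
  B ⊆ Tset n t ∧ ∀ a ∈ B, ∀ b : Mon n, borelLE a b → b ∈ B

/-- Saturation of a monomial ideal:
`J^sat = {m : for every i there is k with x_i^k · m ∈ J}`. -/
def monSat {n : ℕ} (J : Set (Mon n)) : Set (Mon n) :=
  {m | ∀ i : Fin (n + 1), ∃ k : ℕ, (fun l => if l = i then m l + k else m l) ∈ J}

/-- The monomial ideal generated by a set of monomials. -/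
def genIdeal {n : ℕ} (B : Set (Mon n)) : Set (Mon n) :=
  {m | ∃ b ∈ B, ∃ c : Mon n, m = b + c}

/-- The Hilbert function of `S/J` for a monomial ideal `J`: the number of degree-`t`
monomials outside `J`. -/
def hilb {n : ℕ} (J : Set (Mon n)) (t : ℕ) : ℕ :=
  Set.ncard {m : Mon n | mdeg m = t ∧ m ∉ J}

/-- `m / x_i` as an exponent vector. -/
def shrinkAt {n : ℕ} (m : Mon n) (i : Fin (n + 1)) : Mon n :=
  fun l => if l = i then m l - 1 else m l

/-- `m` is a minimal (monomial) generator of the monomial ideal `J`. -/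
def IsMinGen {n : ℕ} (J : Set (Mon n)) (m : Mon n) : Prop :=
  m ∈ J ∧ ∀ i : Fin (n + 1), 1 ≤ m i → shrinkAt m i ∉ J

/-- The Castelnuovo–Mumford regularity of a strongly stable ideal: the maximal degree of a
minimal monomial generator. -/
def monReg {n : ℕ} (J : Set (Mon n)) : ℕ :=
  sSup {d | ∃ m : Mon n, IsMinGen J m ∧ mdeg m = d}

/-- `m_u`: the minimal Castelnuovo–Mumford regularity of a closed projective subscheme with
Hilbert function `u`, i.e. the minimum of `reg J` over all `n` and all saturated strongly
stable ideals `J ⊆ K[x₀,…,xₙ]` with `H_{S/J} = u`. -/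
def mReg (u : ℕ → ℤ) : ℕ :=
  sInf {r | ∃ (n : ℕ) (J : Set (Mon n)), StronglyStable J ∧ monSat J = J ∧
      (∀ t : ℕ, (hilb J t : ℤ) = u t) ∧ monReg J = r}

/-- `M(p,ρ) = {m_u : u ∈ F(p,ρ)}`. -/
def Mset (p : GotzmannPoly) (ρ : ℕ) : Set ℕ := {r | ∃ u ∈ Fset p ρ, mReg u = r}

/-- `m^ρ_p = min M(p,ρ)`. -/
def mRho (p : GotzmannPoly) (ρ : ℕ) : ℕ := sInf (Mset p ρ)

/-- `m_p`: the minimal Castelnuovo–Mumford regularity of schemes with Hilbert polynomial `p`. -/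
def mP (p : GotzmannPoly) : ℕ := sInf {r | ∃ ρ : ℕ, ∃ u ∈ Fset p ρ, mReg u = r}

/-! ## Lex segments and growth-height-lexicographic Borel sets -/

/-- `a` is smaller than `b` in the deglex order (for monomials of the same degree):
`a k < b k` where `k` is the largest index where they differ. -/
def deglexLT {n : ℕ} (a b : Mon n) : Prop :=
  ∃ k : Fin (n + 1), a k < b k ∧ ∀ l : Fin (n + 1), k < l → a l = b l

/-- A lex-segment of `T_t`: a set of degree-`t` monomials consisting of the highest terms
with respect to deglex. -/
def IsLexSeg {n : ℕ} (t : ℕ) (L : Set (Mon n)) : Prop :=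
  L ⊆ Tset n t ∧ ∀ a ∈ L, ∀ b ∈ Tset n t, deglexLT a b → b ∈ L

/-- A lex-segment in `A ⊆ T_t`: the intersection of a lex-segment of `T_t` with `A`. -/
def LexSegIn {n : ℕ} (t : ℕ) (A S : Set (Mon n)) : Prop :=
  ∃ L : Set (Mon n), IsLexSeg t L ∧ S = L ∩ A

/-- The growth class `B^{(i)} = {m ∈ B : min(m) = i}`. -/
def growthClass {n : ℕ} (B : Set (Mon n)) (i : Fin (n + 1)) : Set (Mon n) :=
  {m | m ∈ B ∧ 1 ≤ m i ∧ ∀ j : Fin (n + 1), j < i → m j = 0}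

/-- The height class `B(i) = {m ∈ B : the exponent of x₀ in m is i}`. -/
def heightClass {n : ℕ} (B : Set (Mon n)) (i : ℕ) : Set (Mon n) :=
  {m | m ∈ B ∧ m 0 = i}

/-- A Borel set `B ⊆ T_t` is growth-lexicographic if all its growth classes are lex-segments
in the corresponding growth classes of `T_t`. -/
def GrowthLex {n : ℕ} (t : ℕ) (B : Set (Mon n)) : Prop :=
  ∀ i : Fin (n + 1), LexSegIn t (growthClass (Tset n t) i) (growthClass B i)

/-- A Borel set `B ⊆ T_t` is growth-height-lexicographic if `B(0)` is growth-lexicographic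
and `B(i)` is a lex-segment in `T_t(i)` for every `0 < i ≤ t`. -/
def GHLex {n : ℕ} (t : ℕ) (B : Set (Mon n)) : Prop :=
  GrowthLex t (heightClass B 0) ∧
  ∀ i : ℕ, 0 < i → i ≤ t → LexSegIn t (heightClass (Tset n t) i) (heightClass B i)

end

/-- The rank of the weakly decreasing sequence `x 0 ≥ ⋯ ≥ x (t - 1)`, that is of the monomial
with these variable indices, among all the sequences of length `t`. -/
def rank : ℕ → (ℕ → ℕ) → ℕ
  | 0, _ => 0
  | t + 1, x => Nat.choose (x 0 + t) (t + 1) + rank t (fun j => x (j + 1))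

theorem antitone_tail {x : ℕ → ℕ} (hx : Antitone x) : Antitone (fun j => x (j + 1)) :=
  fun _ _ h => hx (Nat.succ_le_succ h)

theorem rank_mono : ∀ (t : ℕ) {x y : ℕ → ℕ}, (∀ j < t, x j ≤ y j) → rank t x ≤ rank t y
  | 0, _, _, _ => le_rfl
  | t + 1, _, _, h => Nat.add_le_add
      (Nat.choose_le_choose _ (Nat.add_le_add_right (h 0 (Nat.succ_pos t)) t))
      (rank_mono t fun j hj => h (j + 1) (Nat.succ_lt_succ hj))

theorem rank_congr (t : ℕ) {x y : ℕ → ℕ} (h : ∀ j < t, x j = y j) : rank t x = rank t y :=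
  le_antisymm (rank_mono t fun j hj => (h j hj).le) (rank_mono t fun j hj => (h j hj).ge)

theorem rank_zero : ∀ (t : ℕ), rank t (fun _ => 0) = 0
  | 0 => rfl
  | t + 1 => by simp [rank, rank_zero t]

theorem rank_eq_zero (t : ℕ) {x : ℕ → ℕ} (hx : Antitone x) (h : x 0 = 0) : rank t x = 0 := by
  rw [← rank_zero t]
  exact rank_congr t fun j _ => Nat.eq_zero_of_le_zero (h ▸ hx (Nat.zero_le j))

theorem rank_lt_choose : ∀ (t : ℕ) {x : ℕ → ℕ}, Antitone x → rank t x < Nat.choose (x 0 + t) t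
  | 0, _, _ => by simp [rank]
  | t + 1, x, hx => by
    have h1 := rank_lt_choose t (antitone_tail hx)
    have h2 : Nat.choose (x 1 + t) t ≤ Nat.choose (x 0 + t) t :=
      Nat.choose_le_choose _ (Nat.add_le_add_right (hx (Nat.zero_le 1)) t)
    have h3 := Nat.choose_succ_succ (x 0 + t) t
    simp only [rank, Nat.succ_eq_add_one, ← add_assoc] at *
    simp only [zero_add] at *
    omega

/-- A sequence with smaller first entry has smaller rank. -/
theorem rank_lt_of_head {t : ℕ} {x y : ℕ → ℕ} (hx : Antitone x) (h : x 0 < y 0) :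
    rank (t + 1) x < rank (t + 1) y := by
  calc rank (t + 1) x < Nat.choose (x 0 + (t + 1)) (t + 1) := rank_lt_choose _ hx
    _ ≤ Nat.choose (y 0 + t) (t + 1) := Nat.choose_le_choose _ (by omega)
    _ ≤ rank (t + 1) y := Nat.le_add_right _ _

theorem rank_inj : ∀ (t : ℕ) {x y : ℕ → ℕ}, Antitone x → Antitone y → rank t x = rank t y →
    ∀ j < t, x j = y j
  | 0, _, _, _, _, _, _, hj => absurd hj (Nat.not_lt_zero _)
  | t + 1, x, y, hx, hy, h, j, hj => by
    have h0 : x 0 = y 0 := by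
      rcases lt_trichotomy (x 0) (y 0) with h1 | h1 | h1
      · exact absurd h (rank_lt_of_head hx h1).ne
      · exact h1
      · exact absurd h (rank_lt_of_head hy h1).ne'
    have h' : rank t (fun j => x (j + 1)) = rank t (fun j => y (j + 1)) := by
      simpa [rank, h0] using h
    cases j with
    | zero => exact h0
    | succ j =>
      exact rank_inj t (antitone_tail hx) (antitone_tail hy) h' j (Nat.lt_of_succ_lt_succ hj)

/-- If the initial segments of length `t` are ordered strictly, so are the sequences. -/
theorem rank_succ_lt : ∀ (t : ℕ) {x y : ℕ → ℕ}, Antitone x → Antitone y → rank t x < rank t y →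
    rank (t + 1) x < rank (t + 1) y
  | 0, _, _, _, _, h => absurd h (lt_irrefl 0)
  | t + 1, x, y, hx, hy, h => by
    rcases lt_trichotomy (x 0) (y 0) with h1 | h1 | h1
    · exact rank_lt_of_head hx h1
    · have h' : rank t (fun j => x (j + 1)) < rank t (fun j => y (j + 1)) := by
        simpa [rank, h1] using h
      have := rank_succ_lt t (antitone_tail hx) (antitone_tail hy) h'
      rw [rank, rank.eq_def (t + 1 + 1) y, h1]
      exact Nat.add_lt_add_left this _
    · exact absurd h (rank_lt_of_head hy h1).le.not_gt

theorem rank_succ_of_eq : ∀ (t : ℕ) {x y : ℕ → ℕ}, (∀ j < t, x j = y j) →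
    rank (t + 1) x + y t = rank (t + 1) y + x t
  | 0, x, y, _ => by simp [rank, add_comm]
  | t + 1, x, y, h => by
    have := rank_succ_of_eq t (x := fun j => x (j + 1)) (y := fun j => y (j + 1))
      fun j hj => h (j + 1) (Nat.succ_lt_succ hj)
    rw [rank, rank.eq_def (t + 1 + 1) y, h 0 (Nat.succ_pos t)]
    simp only at *
    omega

theorem le_choose_add (k t : ℕ) : k ≤ Nat.choose (k + t) (t + 1) := by
  induction k with
  | zero => simp
  | succ k ih =>
    have h := Nat.choose_succ_succ (k + t) t
    have h2 : 0 < Nat.choose (k + t) t := Nat.choose_pos (Nat.le_add_left t k)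
    rw [Nat.succ_eq_add_one, Nat.succ_eq_add_one] at h
    rw [show k + 1 + t = k + t + 1 by omega]
    omega

theorem head_le_rank (t : ℕ) (x : ℕ → ℕ) : x 0 ≤ rank (t + 1) x :=
  (le_choose_add (x 0) t).trans (Nat.le_add_right _ _)

/-- Every natural number is the rank of a sequence of any given positive length. -/
theorem exists_rank_eq : ∀ (t a : ℕ), ∃ x : ℕ → ℕ, Antitone x ∧ (∀ j, t + 1 ≤ j → x j = 0) ∧
    rank (t + 1) x = a
  | 0, a => by
    refine ⟨fun j => if j = 0 then a else 0, fun i j h => ?_, fun j hj => ?_, ?_⟩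
    · dsimp only; split_ifs <;> omega
    · dsimp only; split_ifs <;> omega
    · simp [rank]
  | t + 1, a => by
    set P : ℕ → Prop := fun k => Nat.choose (k + (t + 1)) (t + 2) ≤ a with hP
    set k := Nat.findGreatest P (a + 1) with hk
    have hPk : P k := Nat.findGreatest_spec (P := P) (Nat.zero_le _) (by simp [hP])
    have hk1 : k ≤ a := (le_choose_add k (t + 1)).trans hPk
    have hPk1 : ¬ P (k + 1) :=
      Nat.findGreatest_is_greatest (P := P) (Nat.lt_succ_self k) (by omega)
    obtain ⟨x, hx, hx0, hr⟩ := exists_rank_eq t (a - Nat.choose (k + (t + 1)) (t + 2))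
    have hxk : x 0 ≤ k := by
      by_contra hlt
      push Not at hlt
      have h1 : Nat.choose (k + 1 + t) (t + 1) ≤ rank (t + 1) x :=
        (Nat.choose_le_choose _ (by omega)).trans (Nat.le_add_right _ _)
      have h2 := Nat.choose_succ_succ (k + (t + 1)) (t + 1)
      simp only [hP, not_le] at hPk1 hPk
      rw [show k + 1 + (t + 1) = (k + (t + 1)).succ by omega] at hPk1
      rw [show k + 1 + t = k + (t + 1) by omega] at h1
      simp only [Nat.succ_eq_add_one] at *
      rw [show t + 1 + 1 = t + 2 from rfl] at h2
      omega
    refine ⟨fun j => if j = 0 then k else x (j - 1), fun i j h => ?_, fun j hj => ?_, ?_⟩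
    · dsimp only
      split_ifs with h1 h2
      · exact le_rfl
      · omega
      · exact (hx (Nat.zero_le _)).trans hxk
      · exact hx (by omega)
    · have : j ≠ 0 := by omega
      simp only [this, if_false]
      exact hx0 _ (by omega)
    · have hPk' : Nat.choose (k + (t + 1)) (t + 2) ≤ a := hPk
      rw [rank]
      simp only [Nat.add_eq_zero_iff, one_ne_zero, and_false, if_false, if_true,
        Nat.add_sub_cancel, hr]
      rw [show t + 1 + 1 = t + 2 from rfl]
      omega

theorem expTop_rank {t : ℕ} {x : ℕ → ℕ} (hx : Antitone x) :
    expTop (rank (t + 1) x) (t + 1) = x 0 + t := by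
  have h1 := head_le_rank t x
  have h2 := rank_lt_choose (t + 1) hx
  unfold expTop
  rw [Nat.findGreatest_eq_iff]
  refine ⟨by omega, fun _ => Nat.le_add_right _ _, fun {m} hm _ => ?_⟩
  rw [not_le]
  exact h2.trans_le (Nat.choose_le_choose _ (by omega))

theorem minusMinus_rank : ∀ (t : ℕ) {x : ℕ → ℕ}, Antitone x →
    minusMinus (rank (t + 1) x) (t + 1) = rank t x + if x t = 0 then 0 else 1
  | t, x, hx => by
    by_cases h0 : x 0 = 0
    · have : x t = 0 := Nat.eq_zero_of_le_zero (h0 ▸ hx (Nat.zero_le t))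
      simp [rank_eq_zero _ hx h0, this, minusMinus]
    have hpos : rank (t + 1) x ≠ 0 := by have := head_le_rank t x; omega
    rw [minusMinus, if_neg hpos, expTop_rank hx, rank, Nat.add_sub_cancel_left]
    cases t with
    | zero =>
      simp [minusMinus, rank, h0]
    | succ t =>
      rw [minusMinus_rank t (antitone_tail hx), rank,
        show x 0 + (t + 1) - 1 = x 0 + t by omega, add_assoc]

theorem plusPlus_rank : ∀ (t : ℕ) {x : ℕ → ℕ}, Antitone x → x t = 0 →
    plusPlus (rank t x) t = rank (t + 1) x
  | 0, x, _, h => by simp [plusPlus, rank, h]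
  | t + 1, x, hx, h => by
    by_cases h0 : x 0 = 0
    · simp [rank_eq_zero _ hx h0, plusPlus]
    have hpos : rank (t + 1) x ≠ 0 := by have := head_le_rank t x; omega
    rw [plusPlus, if_neg hpos, expTop_rank hx, rank, Nat.add_sub_cancel_left,
      plusPlus_rank t (antitone_tail hx) h, rank.eq_def (t + 1 + 1), add_assoc]

theorem antitone_sub {x : ℕ → ℕ} (hx : Antitone x) (k : ℕ) : Antitone (fun j => x j - k) :=
  fun _ _ h => Nat.sub_le_sub_right (hx h) k

theorem rank_succ_eq_add : ∀ (t : ℕ) (x : ℕ → ℕ),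
    rank (t + 1) x = rank t x + (if x t = 0 then 0 else 1) + rank (t + 1) (fun j => x j - 1)
  | 0, x => by
    simp only [rank, zero_add, add_zero, Nat.choose_one_right]
    split_ifs <;> omega
  | t + 1, x => by
    have ih := rank_succ_eq_add t (fun j => x (j + 1))
    have hp : Nat.choose (x 0 + (t + 1)) (t + 1 + 1) =
        Nat.choose (x 0 + t) (t + 1) + Nat.choose (x 0 - 1 + (t + 1)) (t + 1 + 1) := by
      rcases Nat.eq_zero_or_pos (x 0) with h | h
      · simp [h]
      · rw [show x 0 + (t + 1) = x 0 + t + 1 by omega, Nat.choose_succ_succ,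
          show x 0 - 1 + (t + 1) = x 0 + t by omega]
    rw [rank, rank.eq_def (t + 1) x, rank.eq_def (t + 1 + 1) (fun j => x j - 1)]
    simp only at *
    omega

theorem rank_eq_minusMinus_add (t : ℕ) {x : ℕ → ℕ} (hx : Antitone x) :
    rank t x = minusMinus (rank t x) t + rank t (fun j => x j - 1) := by
  cases t with
  | zero => rfl
  | succ t => rw [minusMinus_rank t hx]; exact rank_succ_eq_add t x

/-- Galois connection between the two Macaulay operations. -/
theorem minusMinus_le_iff {a b t : ℕ} (ht : 1 ≤ t) :
    minusMinus b (t + 1) ≤ a ↔ b ≤ plusPlus a t := by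
  obtain ⟨t, rfl⟩ := Nat.exists_eq_add_of_le' ht
  obtain ⟨x, hx, hx0, rfl⟩ := exists_rank_eq t a
  obtain ⟨y, hy, hy0, rfl⟩ := exists_rank_eq (t + 1) b
  rw [minusMinus_rank _ hy, plusPlus_rank _ hx (hx0 _ le_rfl)]
  rcases lt_trichotomy (rank (t + 1) y) (rank (t + 1) x) with h | h | h
  · have h1 := rank_succ_lt _ hy hx h
    constructor
    · intro _; exact h1.le
    · intro _; split_ifs <;> omega
  · have h1 := rank_succ_of_eq (t + 1) (rank_inj _ hy hx h)
    rw [hx0 _ le_rfl] at h1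
    split_ifs with h2 <;> omega
  · have h1 := rank_succ_lt _ hx hy h
    constructor
    · intro h2; split_ifs at h2 <;> omega
    · intro _; omega

theorem minusMinus_zero (t : ℕ) : minusMinus 0 t = 0 := by cases t <;> simp [minusMinus]

theorem minusMinus_le (a t : ℕ) : minusMinus a t ≤ a := by
  cases t with
  | zero => simp [minusMinus]
  | succ t =>
    obtain ⟨x, hx, -, rfl⟩ := exists_rank_eq t a
    have := rank_eq_minusMinus_add (t + 1) hx
    omega

theorem minusMinus_pos {a t : ℕ} (ha : 0 < a) : 0 < minusMinus a (t + 1) := by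
  obtain ⟨x, hx, -, rfl⟩ := exists_rank_eq t a
  have h0 : x 0 ≠ 0 := fun h => by rw [rank_eq_zero _ hx h] at ha; omega
  rw [minusMinus, if_neg ha.ne', expTop_rank hx]
  have := Nat.choose_pos (n := x 0 + t - 1) (k := t) (by omega)
  omega

theorem minusMinus_one {a : ℕ} (ha : 0 < a) : minusMinus a 1 = 1 := by
  simp [minusMinus, ha.ne']

theorem minusMinus_mono {a b : ℕ} (t : ℕ) (h : a ≤ b) : minusMinus a t ≤ minusMinus b t := by
  rcases t with _ | _ | t
  · simp [minusMinus]
  · rcases Nat.eq_zero_or_pos a with rfl | ha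
    · simp [minusMinus_zero]
    · rw [minusMinus_one ha, minusMinus_one (by omega)]
  · rw [minusMinus_le_iff (by omega)]
    exact h.trans ((minusMinus_le_iff (by omega)).1 le_rfl)

theorem plusPlus_mono {a b t : ℕ} (ht : 1 ≤ t) (h : a ≤ b) : plusPlus a t ≤ plusPlus b t :=
  (minusMinus_le_iff ht).1 (((minusMinus_le_iff ht).2 le_rfl).trans h)

theorem minusMinus_plusPlus (a : ℕ) {t : ℕ} (ht : 1 ≤ t) :
    minusMinus (plusPlus a t) (t + 1) = a := by
  obtain ⟨t, rfl⟩ := Nat.exists_eq_add_of_le' ht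
  obtain ⟨x, hx, hx0, rfl⟩ := exists_rank_eq t a
  rw [plusPlus_rank _ hx (hx0 _ le_rfl), minusMinus_rank _ hx, if_pos (hx0 _ le_rfl), add_zero]

theorem minusMinus_succ_le (a t : ℕ) : minusMinus (a + 1) t ≤ minusMinus a t + 1 := by
  rcases t with _ | _ | t
  · simp [minusMinus]
  · rw [minusMinus_one (Nat.succ_pos a)]; omega
  · rw [minusMinus_le_iff (by omega)]
    have h1 : a ≤ plusPlus (minusMinus a (t + 2)) (t + 1) :=
      (minusMinus_le_iff (by omega)).1 le_rfl
    by_contra h2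
    have h3 : plusPlus (minusMinus a (t + 2) + 1) (t + 1) ≤
      plusPlus (minusMinus a (t + 2)) (t + 1) := by
        have h4 : t + 1 + 1 = t + 2 := rfl
        rw [h4] at h2
        omega
    have h4 := minusMinus_mono (t + 2) h3
    rw [minusMinus_plusPlus _ (by omega), minusMinus_plusPlus _ (by omega)] at h4
    omega

theorem sub_minusMinus_mono {a b : ℕ} (t : ℕ) (h : a ≤ b) :
    a - minusMinus a t ≤ b - minusMinus b t := by
  induction b, h using Nat.le_induction with
  | base => exact le_rfl
  | succ b _ ih =>
    have := minusMinus_succ_le b t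
    have := minusMinus_le b t
    omega

theorem plusPlus_eq_add (a : ℕ) {t : ℕ} (ht : 1 ≤ t) :
    plusPlus a t = a + plusPlus (a - minusMinus a t) t := by
  obtain ⟨t, rfl⟩ := Nat.exists_eq_add_of_le' ht
  obtain ⟨x, hx, hx0, rfl⟩ := exists_rank_eq t a
  have h0 := hx0 _ (le_refl (t + 1))
  have h1 : rank (t + 1) x - minusMinus (rank (t + 1) x) (t + 1) =
      rank (t + 1) (fun j => x j - 1) := by
    have := rank_eq_minusMinus_add (t + 1) hx
    omega
  rw [h1, plusPlus_rank _ hx h0, plusPlus_rank _ (antitone_sub hx 1) (by simp [h0]),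
    rank_succ_eq_add (t + 1) x, if_pos h0, add_zero]

/-- The numerical heart of Macaulay's bound for strongly stable sets. -/
theorem minusMinus_add_le {a b t : ℕ}
    (h : minusMinus b (t + 1) ≤ a - minusMinus a t) : minusMinus (a + b) (t + 1) ≤ a := by
  rcases Nat.eq_zero_or_pos t with rfl | ht
  · rcases Nat.eq_zero_or_pos a with rfl | ha
    · simpa using h
    · rw [minusMinus_one (by omega)]; exact ha
  · rw [minusMinus_le_iff ht] at h ⊢
    rw [plusPlus_eq_add a ht]
    omega

/-- Truncated growth of `a - (a_t)^-_-`. -/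
theorem minusMinus_sub_le {a : ℕ} {t : ℕ} (ht : 1 ≤ t) :
    minusMinus (a - minusMinus a (t + 1)) (t + 1) ≤
      minusMinus a (t + 1) - minusMinus (minusMinus a (t + 1)) t := by
  rw [minusMinus_le_iff ht]
  set b := minusMinus a (t + 1)
  have h1 : a ≤ plusPlus b t := (minusMinus_le_iff ht).1 le_rfl
  have h2 := sub_minusMinus_mono (t + 1) h1
  rw [minusMinus_plusPlus _ ht] at h2
  have h3 := plusPlus_eq_add b ht
  omega

theorem rank_lt_of_lt_sub {t a : ℕ} {x : ℕ → ℕ} (hx : Antitone x)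
    (h : rank t (fun j => x j - 1) < a - minusMinus a t) : rank t x < a := by
  by_contra hle
  have := sub_minusMinus_mono t (not_lt.1 hle)
  have := rank_eq_minusMinus_add t hx
  omega

theorem rank_lt_minusMinus {t a : ℕ} {x : ℕ → ℕ} (hx : Antitone x) (h : rank (t + 1) x < a) :
    rank t x < minusMinus a (t + 1) := by
  have h1 := minusMinus_mono (t + 1) (Nat.succ_le_of_lt h)
  refine lt_of_lt_of_le ?_ h1
  rw [← not_le]
  intro h2
  rcases Nat.eq_zero_or_pos t with rfl | ht
  · rw [minusMinus_one (Nat.succ_pos _)] at h2; simp [rank] at h2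
  · rw [minusMinus_le_iff ht] at h2
    have h3 : plusPlus (rank t x) t ≤ rank (t + 1) x := by
      set y : ℕ → ℕ := fun j => if j < t then x j else 0 with hy
      have hya : Antitone y := fun i j hij => by
        simp only [hy]; split_ifs
        · exact hx hij
        · omega
        · omega
        · omega
      rw [rank_congr t (x := x) (y := y) (fun j hj => by simp [hy, hj]),
        plusPlus_rank t hya (by simp [hy])]
      exact rank_mono _ fun j _ => by simp only [hy]; split_ifs <;> omega
    omega

theorem OSeq.minusMinus_le {H : ℕ → ℤ} (hH : OSeq H) (t : ℕ) :
    (minusMinus (H (t + 1)).toNat (t + 1) : ℤ) ≤ H t := by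
  rcases Nat.eq_zero_or_pos t with rfl | ht
  · rw [hH.2.1]
    rcases Nat.eq_zero_or_pos (H (0 + 1)).toNat with h | h
    · rw [h, minusMinus_zero]; simp
    · rw [minusMinus_one h]; simp
  · have h := hH.2.2 t ht
    have h0 := hH.1 t
    have h1 : (H (t + 1)).toNat ≤ plusPlus (H t).toNat t := by omega
    have h2 := (minusMinus_le_iff ht).2 h1
    omega

theorem toNat_le_plusPlus {a b : ℤ} {t : ℕ} (ht : 1 ≤ t)
    (h : (minusMinus b.toNat (t + 1) : ℤ) ≤ a) : b ≤ (plusPlus a.toNat t : ℤ) := by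
  have h1 : minusMinus b.toNat (t + 1) ≤ a.toNat := by omega
  have h2 := (minusMinus_le_iff ht).1 h1
  omega

theorem plusPlus_toNat_mono {a b : ℤ} {t : ℕ} (ht : 1 ≤ t) (h : a ≤ b) :
    (plusPlus a.toNat t : ℤ) ≤ (plusPlus b.toNat t : ℤ) :=
  Int.ofNat_le.2 (plusPlus_mono ht (Int.toNat_le_toNat h))

theorem OSeq.one_le_of_nderiv {u : ℕ → ℤ} (hu : OSeq u) (hd : OSeq (nderiv u)) (t : ℕ) :
    1 ≤ u t := by
  induction t with
  | zero => exact hu.2.1.ge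
  | succ t ih =>
    have := hd.1 (t + 1)
    simp only [nderiv] at this
    omega

section Descend

variable {H : ℕ → ℤ} {σ : ℕ}

theorem descend_pos
    (hdesc : ∀ t < σ, H t = (minusMinus (H (t + 1)).toNat (t + 1) : ℤ))
    (hσ : 1 ≤ H σ) : ∀ t ≤ σ, 1 ≤ H t := by
  intro t ht
  induction ht using Nat.decreasingInduction with
  | self => exact hσ
  | of_succ t ht ih =>
    rw [hdesc t ht]
    have := minusMinus_pos (a := (H (t + 1)).toNat) (t := t) (by omega)
    omega

theorem descend_zero
    (hdesc : ∀ t < σ, H t = (minusMinus (H (t + 1)).toNat (t + 1) : ℤ))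
    (hσ : 1 ≤ H σ) (h0 : σ = 0 → H 0 = 1) : H 0 = 1 := by
  rcases Nat.eq_zero_or_pos σ with h | h
  · exact h0 h
  · rw [hdesc 0 h, minusMinus_one]
    · rfl
    · have := descend_pos hdesc hσ 1 h
      simp only [zero_add]
      omega

theorem descend_oSeq
    (hdesc : ∀ t < σ, H t = (minusMinus (H (t + 1)).toNat (t + 1) : ℤ))
    (hσ : 1 ≤ H σ) (h0 : σ = 0 → H 0 = 1) (hnn : ∀ t, σ ≤ t → 0 ≤ H t)
    (hgr : ∀ t, σ ≤ t → 1 ≤ t → H (t + 1) ≤ (plusPlus (H t).toNat t : ℤ)) : OSeq H := by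
  refine ⟨fun t => ?_, descend_zero hdesc hσ h0, fun t ht => ?_⟩
  · rcases le_total σ t with h | h
    · exact hnn t h
    · exact zero_le_one.trans (descend_pos hdesc hσ t h)
  · rcases le_or_gt σ t with h | h
    · exact hgr t h ht
    · exact toNat_le_plusPlus ht (hdesc t h).ge

theorem descend_nderiv
    (hdesc : ∀ t < σ, H t = (minusMinus (H (t + 1)).toNat (t + 1) : ℤ))
    (hσ : 1 ≤ H σ) {t : ℕ} (ht : t < σ) :
    (nderiv H (t + 1)).toNat = (H (t + 1)).toNat - minusMinus (H (t + 1)).toNat (t + 1) ∧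
      0 ≤ nderiv H (t + 1) := by
  have h1 := descend_pos hdesc hσ (t + 1) ht
  have h2 := minusMinus_le (H (t + 1)).toNat (t + 1)
  simp only [nderiv, hdesc t ht]
  omega

theorem descend_oSeq_nderiv
    (hdesc : ∀ t < σ, H t = (minusMinus (H (t + 1)).toNat (t + 1) : ℤ))
    (hσ : 1 ≤ H σ) (hnn : ∀ t, σ ≤ t → H t ≤ H (t + 1))
    (hgr : ∀ t, σ ≤ t → 1 ≤ t →
      nderiv H (t + 1) ≤ (plusPlus (nderiv H t).toNat t : ℤ)) : OSeq (nderiv H) := by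
  refine ⟨fun t => ?_, rfl, fun t ht => ?_⟩
  · cases t with
    | zero => simp [nderiv]
    | succ t =>
      rcases le_or_gt σ t with h | h
      · simpa [nderiv] using hnn t h
      · exact (descend_nderiv hdesc hσ h).2
  · rcases le_or_gt σ t with h | h
    · exact hgr t h ht
    · refine toNat_le_plusPlus ht ?_
      obtain ⟨t, rfl⟩ := Nat.exists_eq_add_of_le' ht
      have h1 := (descend_nderiv hdesc hσ h).1
      have h2 := descend_nderiv hdesc hσ (t := t) (by omega)
      have h3 := minusMinus_sub_le (a := (H (t + 1 + 1)).toNat) ht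
      have h4 := hdesc (t + 1) h
      have h5 : minusMinus (H (t + 1 + 1)).toNat (t + 1 + 1) = (H (t + 1)).toNat := by omega
      rw [h1]
      rw [h5] at h3 ⊢
      omega

end Descend

theorem fmin_of_le {p : GotzmannPoly} {ρ t : ℕ} (h : ρ ≤ t) : fmin p ρ t = p.eval t := by
  rw [fmin, dif_pos h]

theorem fmin_of_lt {p : GotzmannPoly} {ρ t : ℕ} (h : t < ρ) :
    fmin p ρ t = (minusMinus (fmin p ρ (t + 1)).toNat (t + 1) : ℤ) := by
  rw [fmin, dif_neg h.not_ge]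

theorem gmin_of_le {p : GotzmannPoly} {ρ t : ℕ} (h : ρ ≤ t) : gmin p ρ t = p.eval t := by
  rw [gmin, dif_pos h]

theorem gmin_pred {p : GotzmannPoly} {ρ t : ℕ} (h : t + 1 = ρ) :
    gmin p ρ t = p.eval t + 1 := by
  rw [gmin, dif_neg (by omega), if_pos (by omega)]

theorem gmin_of_lt {p : GotzmannPoly} {ρ t : ℕ} (h : t + 1 < ρ) :
    gmin p ρ t = (minusMinus (gmin p ρ (t + 1)).toNat (t + 1) : ℤ) := by
  rw [gmin, dif_neg (by omega), if_neg (by omega)]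

section Minimal

variable {p : GotzmannPoly} {ρ : ℕ} {u : ℕ → ℤ}

/-- The value at `ρ - 1` of the minimal function bounds that of all the others from below. -/
theorem fmin_le_of_mem (hu : u ∈ Fset p (ρ + 1)) : fmin p (ρ + 1) ρ ≤ u ρ := by
  rw [fmin_of_lt (Nat.lt_succ_self ρ), fmin_of_le le_rfl, ← hu.2.2.1 (ρ + 1) le_rfl]
  exact hu.1.minusMinus_le ρ

theorem fmin_oSeq (hu : u ∈ Fset p ρ) :
    OSeq (fmin p ρ) ∧ OSeq (nderiv (fmin p ρ)) := by
  obtain ⟨h1, h2, h3⟩ := id hu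
  have hp : ∀ t, ρ ≤ t → fmin p ρ t = u t := fun t ht => by
    rw [fmin_of_le ht, h3.1 t ht]
  have hdesc : ∀ t < ρ, fmin p ρ t = (minusMinus (fmin p ρ (t + 1)).toNat (t + 1) : ℤ) :=
    fun t => fmin_of_lt
  have hσ : 1 ≤ fmin p ρ ρ := by rw [hp ρ le_rfl]; exact h1.one_le_of_nderiv h2 ρ
  refine ⟨descend_oSeq hdesc hσ ?_ ?_ ?_, descend_oSeq_nderiv hdesc hσ ?_ ?_⟩
  · rintro rfl; rw [hp 0 le_rfl]; exact h1.2.1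
  · intro t ht; rw [hp t ht]; exact h1.1 t
  · intro t ht ht1; rw [hp t ht, hp (t + 1) (by omega)]; exact h1.2.2 t ht1
  · intro t ht
    rw [hp t ht, hp (t + 1) (by omega)]
    have := h2.1 (t + 1)
    simp only [nderiv] at this
    omega
  · intro t ht ht1
    obtain ⟨t, rfl⟩ := Nat.exists_eq_add_of_le' ht1
    have h4 := h2.2.2 (t + 1) ht1
    have h5 : nderiv (fmin p ρ) (t + 1 + 1) = nderiv u (t + 1 + 1) := by
      simp only [nderiv]; rw [hp _ ht, hp _ (by omega)]
    rw [h5]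
    refine h4.trans (plusPlus_toNat_mono ht1 ?_)
    simp only [nderiv]
    rw [hp _ ht]
    rcases Nat.lt_or_ge t ρ with h | h
    · obtain rfl : ρ = t + 1 := by omega
      have := fmin_le_of_mem hu
      omega
    · rw [hp _ h]

theorem isRegOf_ne {H : ℕ → ℤ} (h : IsRegOf p H (ρ + 1)) : H ρ ≠ p.eval ρ := by
  intro h1
  have := h.2 ρ fun t ht => by
    rcases Nat.eq_or_lt_of_le ht with rfl | h2
    · exact h1
    · exact h.1 t h2
  omega

theorem isRegOf_of_ne {H : ℕ → ℤ} (h : ∀ t : ℕ, ρ + 1 ≤ t → H t = p.eval t)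
    (h1 : H ρ ≠ p.eval ρ) : IsRegOf p H (ρ + 1) := by
  refine ⟨h, fun ρ' h' => ?_⟩
  by_contra h2
  exact h1 (h' ρ (by omega))

/-- If the minimal function drops regularity, then `g` belongs to the same class. -/
theorem gmin_mem (hu : u ∈ Fset p (ρ + 1)) (hf : fmin p (ρ + 1) ρ = p.eval ρ) :
    gmin p (ρ + 1) ∈ Fset p (ρ + 1) := by
  obtain ⟨h1, h2, h3⟩ := id hu
  obtain ⟨hf1, hf2⟩ := fmin_oSeq hu
  have hlt : p.eval ρ + 1 ≤ u ρ := by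
    have := fmin_le_of_mem hu
    have := isRegOf_ne h3
    omega
  have hρ : 1 ≤ ρ := by
    rcases Nat.eq_zero_or_pos ρ with rfl | h
    · have := hf1.2.1
      have := h1.2.1
      omega
    · exact h
  have hp : ∀ t, ρ + 1 ≤ t → gmin p (ρ + 1) t = u t := fun t ht => by
    rw [gmin_of_le ht, h3.1 t ht]
  have hpf : ∀ t, ρ + 1 ≤ t → fmin p (ρ + 1) t = u t := fun t ht => by
    rw [fmin_of_le ht, h3.1 t ht]
  have hg : gmin p (ρ + 1) ρ = p.eval ρ + 1 := gmin_pred rfl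
  have hdesc : ∀ t < ρ,
      gmin p (ρ + 1) t = (minusMinus (gmin p (ρ + 1) (t + 1)).toNat (t + 1) : ℤ) :=
    fun t ht => gmin_of_lt (by omega)
  have hfpos := hf1.one_le_of_nderiv hf2 ρ
  have hσ : 1 ≤ gmin p (ρ + 1) ρ := by omega
  refine ⟨descend_oSeq hdesc hσ (by omega) ?_ ?_, descend_oSeq_nderiv hdesc hσ ?_ ?_,
    isRegOf_of_ne (fun t => gmin_of_le) (by omega)⟩
  · intro t ht
    rcases Nat.eq_or_lt_of_le ht with rfl | h
    · omega
    · rw [hp t h]; exact h1.1 t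
  · intro t ht ht1
    rcases Nat.eq_or_lt_of_le ht with rfl | h
    · have h5 := hf1.2.2 ρ ht1
      rw [hp _ le_rfl]
      rw [hpf _ le_rfl] at h5
      exact h5.trans (plusPlus_toNat_mono ht1 (by omega))
    · rw [hp t h, hp (t + 1) (by omega)]; exact h1.2.2 t ht1
  · intro t ht
    have h5 := h2.1 (t + 1)
    simp only [nderiv] at h5
    rcases Nat.eq_or_lt_of_le ht with rfl | h
    · rw [hg, hp _ le_rfl]; omega
    · rw [hp t h, hp (t + 1) (by omega)]
      omega
  · intro t ht ht1
    rcases Nat.eq_or_lt_of_le ht with rfl | h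
    · have h5 := hf2.2.2 ρ ht1
      have h6 : nderiv (gmin p (ρ + 1)) (ρ + 1) ≤ nderiv (fmin p (ρ + 1)) (ρ + 1) := by
        simp only [nderiv]
        rw [hp _ le_rfl, hpf _ le_rfl]
        omega
      refine h6.trans (h5.trans (plusPlus_toNat_mono ht1 ?_))
      obtain ⟨k, rfl⟩ := Nat.exists_eq_add_of_le' ht1
      have hdescf : ∀ t < k + 1, fmin p (k + 1 + 1) t =
          (minusMinus (fmin p (k + 1 + 1) (t + 1)).toNat (t + 1) : ℤ) :=
        fun t ht => fmin_of_lt (by omega)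
      have h7 := descend_nderiv hdesc hσ (Nat.lt_succ_self k)
      have h8 := descend_nderiv hdescf hfpos (Nat.lt_succ_self k)
      have h9 := sub_minusMinus_mono (a := (fmin p (k + 1 + 1) (k + 1)).toNat)
        (b := (gmin p (k + 1 + 1) (k + 1)).toNat) (k + 1) (by omega)
      rw [← h7.1, ← h8.1] at h9
      omega
    · obtain ⟨t, rfl⟩ := Nat.exists_eq_add_of_le' ht1
      have h4 := h2.2.2 (t + 1) ht1
      have h5 : nderiv (gmin p (ρ + 1)) (t + 1 + 1) = nderiv u (t + 1 + 1) := by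
        simp only [nderiv]; rw [hp _ h, hp _ (by omega)]
      rw [h5]
      refine h4.trans (plusPlus_toNat_mono ht1 ?_)
      simp only [nderiv]
      rw [hp _ h]
      rcases Nat.eq_or_lt_of_le ht with h6 | h6
      · obtain rfl : ρ = t := by omega
        omega
      · rcases Nat.eq_or_lt_of_le (Nat.le_of_lt_succ h) with h8 | h8
        · subst h8; omega
        · rw [hp _ (by omega)]

end Minimal

/-- The exponent vector of the variable `x_i` (zero if `i > n`). -/
def varExp (n i : ℕ) : Mon n := fun l => if l.val = i then 1 else 0

/-- The variables `x_j` with `j < i` do not occur in `m`. -/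
def StartsAt {n : ℕ} (i : ℕ) (m : Mon n) : Prop := ∀ j : Fin (n + 1), j.val < i → m j = 0

theorem mdeg_add {n : ℕ} (a b : Mon n) : mdeg (a + b) = mdeg a + mdeg b := by
  simp [mdeg, Finset.sum_add_distrib]

theorem mdeg_varExp {n i : ℕ} (hi : i ≤ n) : mdeg (varExp n i) = 1 := by
  have : ∀ l : Fin (n + 1), varExp n i l = if l = ⟨i, by omega⟩ then 1 else 0 := fun l => by
    simp [varExp, Fin.ext_iff]
  simp [mdeg, this]

theorem mdeg_add_varExp {n i : ℕ} (hi : i ≤ n) (m : Mon n) :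
    mdeg (m + varExp n i) = mdeg m + 1 := by
  rw [mdeg_add, mdeg_varExp hi]

theorem le_mdeg {n : ℕ} (m : Mon n) (i : Fin (n + 1)) : m i ≤ mdeg m :=
  Finset.single_le_sum (f := m) (fun _ _ => Nat.zero_le _) (Finset.mem_univ i)

theorem finite_mdeg (n t : ℕ) : {m : Mon n | mdeg m = t}.Finite :=
  (Set.finite_Iic (fun _ : Fin (n + 1) => t)).subset fun m hm i =>
    (le_mdeg m i).trans_eq hm

theorem finite_of_mdeg {n t : ℕ} {D : Set (Mon n)} (h : ∀ m ∈ D, mdeg m = t) : D.Finite :=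
  (finite_mdeg n t).subset h

theorem startsAt_zero {n : ℕ} (m : Mon n) : StartsAt 0 m := fun _ h => absurd h (Nat.not_lt_zero _)

theorem startsAt_add {n i : ℕ} {a b : Mon n} :
    StartsAt i (a + b) ↔ StartsAt i a ∧ StartsAt i b := by
  simp only [StartsAt, Pi.add_apply, Nat.add_eq_zero_iff]
  exact ⟨fun h => ⟨fun j hj => (h j hj).1, fun j hj => (h j hj).2⟩,
    fun h j hj => ⟨h.1 j hj, h.2 j hj⟩⟩

theorem startsAt_varExp {n i k : ℕ} (h : i ≤ k) : StartsAt i (varExp n k) := fun j hj => by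
  simp only [varExp]; rw [if_neg]; omega

theorem StartsAt.mono {n i k : ℕ} {m : Mon n} (h : StartsAt k m) (hik : i ≤ k) : StartsAt i m :=
  fun j hj => h j (by omega)

theorem StartsAt.eq_zero {n i : ℕ} {m : Mon n} (h : StartsAt i m) (hi : n < i) : m = 0 := by
  ext j; exact h j (by omega)

theorem startsAt_succ_iff {n i : ℕ} (hi : i < n + 1) {m : Mon n} :
    StartsAt (i + 1) m ↔ StartsAt i m ∧ m ⟨i, hi⟩ = 0 := by
  refine ⟨fun h => ⟨h.mono (by omega), h _ (by simp)⟩, fun h j hj => ?_⟩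
  rcases Nat.lt_or_ge j.val i with h1 | h1
  · exact h.1 j h1
  · have : j = ⟨i, hi⟩ := Fin.ext (by simp; omega)
    rw [this]; exact h.2

theorem exists_eq_add_varExp {n i : ℕ} (hi : i < n + 1) {m : Mon n} (h : m ⟨i, hi⟩ ≠ 0) :
    ∃ m', m = m' + varExp n i := by
  refine ⟨fun l => if l.val = i then m l - 1 else m l, ?_⟩
  ext l
  simp only [Pi.add_apply, varExp]
  split_ifs with h1
  · have : l = ⟨i, hi⟩ := Fin.ext h1
    rw [this]; omega
  · rfl

/-- Splitting a finite set of monomials by divisibility by `x_i`. -/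
theorem ncard_split {n t i : ℕ} (hi : i < n + 1) {D : Set (Mon n)} (hD : ∀ m ∈ D, mdeg m = t) :
    D.ncard = {m | m + varExp n i ∈ D}.ncard + {m | m ∈ D ∧ m ⟨i, hi⟩ = 0}.ncard := by
  have hfin := finite_of_mdeg hD
  have h1 : {m | m + varExp n i ∈ D}.ncard = {m | m ∈ D ∧ m ⟨i, hi⟩ ≠ 0}.ncard := by
    rw [← Set.ncard_image_of_injective {m | m + varExp n i ∈ D}
      (add_left_injective (varExp n i))]
    congr 1
    ext m
    constructor
    · rintro ⟨m', hm', rfl⟩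
      exact ⟨hm', by simp [varExp]⟩
    · rintro ⟨hm, h0⟩
      obtain ⟨m', rfl⟩ := exists_eq_add_varExp hi h0
      exact ⟨m', hm, rfl⟩
  have h2 : D = {m | m ∈ D ∧ m ⟨i, hi⟩ ≠ 0} ∪ {m | m ∈ D ∧ m ⟨i, hi⟩ = 0} := by
    ext m
    simp only [Set.mem_union, Set.mem_ofPred_eq]
    tauto
  rw [h1, ← Set.ncard_union_eq _ (hfin.subset fun m hm => hm.1) (hfin.subset fun m hm => hm.1),
    ← h2]
  rw [Set.disjoint_left]
  intro m hm hk
  exact hm.2 hk.2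

/-- Macaulay's bound: among the sets of monomials in `x_i, …, x_n` of degree `t` which are closed
under lowering variables, lex ones have the fewest multiples of `x_i`. -/
theorem macaulay_bound {n : ℕ} (N : ℕ) : ∀ {t i : ℕ} {D : Set (Mon n)}, t + (n + 1 - i) ≤ N →
    (∀ m ∈ D, mdeg m = t) → (∀ m ∈ D, StartsAt i m) →
    (∀ (m : Mon n) (j k : ℕ), i ≤ k → k ≤ j → j ≤ n → m + varExp n j ∈ D → m + varExp n k ∈ D) →
    minusMinus D.ncard t ≤ {m | m + varExp n i ∈ D}.ncard := by
  induction N with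
  | zero =>
    intro t i D hN _ _ _
    obtain rfl : t = 0 := by omega
    simp [minusMinus]
  | succ N ih =>
    intro t i D hN hdeg hst hcl
    rcases t with _ | t
    · simp [minusMinus]
    rcases Nat.lt_or_ge n i with hi | hi
    · have : D = ∅ := by
        rw [Set.eq_empty_iff_forall_notMem]
        intro m hm
        have h1 := hdeg m hm
        rw [(hst m hm).eq_zero hi] at h1
        simp [mdeg] at h1
      simp [this, minusMinus]
    have hi' : i < n + 1 := by omega
    set D₁ : Set (Mon n) := {m | m + varExp n i ∈ D} with hD₁
    set D₂ : Set (Mon n) := {m | m ∈ D ∧ m ⟨i, hi'⟩ = 0} with hD₂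
    have hdeg₁ : ∀ m ∈ D₁, mdeg m = t := fun m hm => by
      have := hdeg _ hm
      rw [mdeg_add_varExp hi] at this
      omega
    have h1 := ncard_split hi' hdeg
    have h2 := ncard_split hi' hdeg₁
    have ih₁ := ih (t := t) (i := i) (D := D₁) (by omega) hdeg₁
      (fun m hm => (startsAt_add.1 (hst _ hm)).1) fun m j k hk hkj hj hm => by
        have := hcl (m + varExp n i) j k hk hkj hj (by rwa [add_right_comm])
        rwa [add_right_comm] at this
    have ih₂ := ih (t := t + 1) (i := i + 1) (D := D₂) (by omega) (fun m hm => hdeg m hm.1)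
      (fun m hm => (startsAt_succ_iff hi').2 ⟨hst m hm.1, hm.2⟩) fun m j k hk hkj hj hm => by
        refine ⟨hcl m j k (by omega) hkj hj hm.1, ?_⟩
        have h0 := hm.2
        simp only [Pi.add_apply, Nat.add_eq_zero_iff, varExp] at h0 ⊢
        refine ⟨h0.1, ?_⟩
        rw [if_neg]; omega
    have hsub : {m | m + varExp n (i + 1) ∈ D₂}.ncard ≤
        {m | m ∈ D₁ ∧ m ⟨i, hi'⟩ = 0}.ncard := by
      refine Set.ncard_le_ncard ?_ ((finite_of_mdeg hdeg₁).subset fun m hm => hm.1)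
      intro m hm
      rcases Nat.lt_or_ge n (i + 1) with hlt | hge
      · have h3 := hdeg _ hm.1
        rw [((startsAt_succ_iff hi').2 ⟨hst _ hm.1, hm.2⟩).eq_zero hlt] at h3
        simp [mdeg] at h3
      · have h0 := hm.2
        simp only [Pi.add_apply, Nat.add_eq_zero_iff] at h0
        exact ⟨hcl m (i + 1) i le_rfl (by omega) hge hm.1, h0.1⟩
    change D.ncard = D₁.ncard + D₂.ncard at h1
    rw [h1]
    exact minusMinus_add_le (by omega)

/-- Number of the monomials of degree `t` in `x_i, …, x_n` outside `J`. -/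
noncomputable def cnt {n : ℕ} (J : Set (Mon n)) (i t : ℕ) : ℕ :=
  {m : Mon n | mdeg m = t ∧ m ∉ J ∧ StartsAt i m}.ncard

/-- Number of the monomials `m` of degree `t` in `x_i, …, x_n` such that `x_i m` is outside `J`. -/
noncomputable def growth {n : ℕ} (J : Set (Mon n)) (i t : ℕ) : ℕ :=
  cnt J i (t + 1) - cnt J (i + 1) (t + 1)

theorem cnt_zero {n : ℕ} (J : Set (Mon n)) (t : ℕ) : cnt J 0 t = hilb J t := by
  simp [cnt, hilb, startsAt_zero]

section Stable

variable {n : ℕ} {J : Set (Mon n)}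

theorem finite_cnt (J : Set (Mon n)) (i t : ℕ) :
    {m : Mon n | mdeg m = t ∧ m ∉ J ∧ StartsAt i m}.Finite :=
  finite_of_mdeg fun _ hm => hm.1

theorem cnt_of_lt {i t : ℕ} (hi : n < i) : cnt J i (t + 1) = 0 := by
  rw [cnt, Set.ncard_eq_zero (finite_cnt J i _), Set.eq_empty_iff_forall_notMem]
  rintro m ⟨h1, -, h2⟩
  rw [h2.eq_zero hi] at h1
  simp [mdeg] at h1

theorem cnt_succ_le (i t : ℕ) : cnt J (i + 1) t ≤ cnt J i t :=
  Set.ncard_le_ncard (fun _ hm => ⟨hm.1, hm.2.1, hm.2.2.mono (Nat.le_succ i)⟩) (finite_cnt J i t)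

theorem growth_add (J : Set (Mon n)) (i t : ℕ) :
    cnt J i (t + 1) = growth J i t + cnt J (i + 1) (t + 1) := by
  have := cnt_succ_le (J := J) i (t + 1)
  rw [growth]; omega

theorem growth_of_lt {i t : ℕ} (hi : n < i) : growth J i t = 0 := by
  rw [growth, cnt_of_lt hi, Nat.zero_sub]

theorem growth_eq {i t : ℕ} (hi : i ≤ n) :
    growth J i t = {m : Mon n | mdeg m = t ∧ m + varExp n i ∉ J ∧ StartsAt i m}.ncard := by
  have h1 := growth_add J i t
  have h2 := ncard_split (Nat.lt_succ_of_le hi)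
    (D := {m : Mon n | mdeg m = t + 1 ∧ m ∉ J ∧ StartsAt i m}) (fun m hm => hm.1)
  have h3 : {m : Mon n | m + varExp n i ∈ {m : Mon n | mdeg m = t + 1 ∧ m ∉ J ∧ StartsAt i m}} =
      {m : Mon n | mdeg m = t ∧ m + varExp n i ∉ J ∧ StartsAt i m} := by
    ext m
    simp only [Set.mem_ofPred_eq, mdeg_add_varExp hi, startsAt_add,
      startsAt_varExp (n := n) (le_refl i), and_true, Nat.add_right_cancel_iff]
  have h4 : {m : Mon n | m ∈ {m : Mon n | mdeg m = t + 1 ∧ m ∉ J ∧ StartsAt i m} ∧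
      m ⟨i, Nat.lt_succ_of_le hi⟩ = 0} =
      {m : Mon n | mdeg m = t + 1 ∧ m ∉ J ∧ StartsAt (i + 1) m} := by
    ext m
    simp only [Set.mem_ofPred_eq, startsAt_succ_iff (Nat.lt_succ_of_le hi), and_assoc]
  rw [h3, h4] at h2
  simp only [cnt] at h1 h2
  omega

theorem StronglyStable.add_varExp (hJ : StronglyStable J) {m : Mon n} {j i : ℕ} (hji : j ≤ i)
    (hi : i ≤ n) (h : m + varExp n j ∈ J) : m + varExp n i ∈ J := by
  rcases Nat.eq_or_lt_of_le hji with rfl | hlt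
  · exact h
  have h1 := hJ.2 _ h ⟨j, by omega⟩ ⟨i, by omega⟩ hlt (by simp [varExp])
  convert h1 using 1
  ext l
  simp only [borelStep, Pi.add_apply, varExp, Fin.ext_iff]
  split_ifs <;> omega

theorem macaulay_growth (hJ : StronglyStable J) (i t : ℕ) :
    minusMinus (growth J i t) t + growth J (i + 1) t ≤ growth J i t := by
  rcases Nat.lt_or_ge n (i + 1) with hlt | hge
  · rw [growth_of_lt hlt, add_zero]; exact minusMinus_le _ _
  have hi : i < n + 1 := by omega
  rw [growth_eq hge, growth_eq (show i ≤ n by omega)]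
  set D : Set (Mon n) := {m : Mon n | mdeg m = t ∧ m + varExp n i ∉ J ∧ StartsAt i m} with hD
  have h1 := macaulay_bound _ (t := t) (i := i) (D := D) le_rfl (fun m hm => hm.1)
    (fun m hm => hm.2.2) fun m j k hik hkj hj hm => by
      refine ⟨?_, fun h => hm.2.1 ?_, startsAt_add.2 ⟨(startsAt_add.1 hm.2.2).1,
        startsAt_varExp hik⟩⟩
      · have := hm.1
        rw [mdeg_add_varExp hj] at this
        rwa [mdeg_add_varExp (by omega)]
      · rw [add_right_comm] at h ⊢
        exact hJ.add_varExp hkj hj h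
  have h2 := ncard_split hi (D := D) fun m hm => hm.1
  have h3 : {m : Mon n | mdeg m = t ∧ m + varExp n (i + 1) ∉ J ∧ StartsAt (i + 1) m}.ncard ≤
      {m | m ∈ D ∧ m ⟨i, hi⟩ = 0}.ncard := by
    refine Set.ncard_le_ncard ?_ ((finite_of_mdeg (D := D) fun m hm => hm.1).subset
      fun m hm => hm.1)
    rintro m ⟨h4, h5, h6⟩
    rw [startsAt_succ_iff hi] at h6
    exact ⟨⟨h4, fun h => h5 (hJ.add_varExp (Nat.le_succ i) hge h), h6.1⟩, h6.2⟩
  omega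

theorem growth_le_cnt (hJ : MonIdeal J) (i t : ℕ) : growth J i t ≤ cnt J i t := by
  rcases Nat.lt_or_ge n i with hlt | hge
  · rw [growth_of_lt hlt]; exact Nat.zero_le _
  rw [growth_eq hge]
  exact Set.ncard_le_ncard (fun m hm => ⟨hm.1, fun h => hm.2.1 (hJ m h _), hm.2.2⟩)
    (finite_cnt J i t)

/-- All the minimal generators of `J` have degree at most `s`. -/
def GenDegLE (J : Set (Mon n)) (s : ℕ) : Prop := ∀ m, IsMinGen J m → mdeg m ≤ s

theorem shrinkAt_add_varExp {m : Mon n} (i : Fin (n + 1)) (h : 1 ≤ m i) :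
    shrinkAt m i + varExp n i = m := by
  ext l
  simp only [shrinkAt, Pi.add_apply, varExp, Fin.ext_iff]
  split_ifs with h1
  · rw [Fin.ext h1]; omega
  · rfl

theorem GenDegLE.mem_of_add_mem {s : ℕ} (hs : GenDegLE J s) (hJ : StronglyStable J) {m : Mon n}
    {i : ℕ} (hi : i ≤ n) (hst : StartsAt i m) (hdeg : s ≤ mdeg m) (h : m + varExp n i ∈ J) :
    m ∈ J := by
  have h1 : ¬ IsMinGen J (m + varExp n i) := fun h2 => by
    have := hs _ h2
    rw [mdeg_add_varExp hi] at this
    omega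
  simp only [IsMinGen, not_and, not_forall, not_not] at h1
  obtain ⟨j, hj, hjm⟩ := h1 h
  have h2 := shrinkAt_add_varExp j hj
  by_cases hji : j.val = i
  · rw [hji] at h2
    rwa [add_right_cancel h2] at hjm
  · have hmj : m j ≠ 0 := by
      simp only [Pi.add_apply, varExp, if_neg hji] at hj; omega
    obtain ⟨w, rfl⟩ := exists_eq_add_varExp j.isLt hmj
    have hij : i ≤ j.val := by
      by_contra hlt
      exact hmj (hst j (by omega))
    rw [add_right_cancel (h2.trans (add_right_comm _ _ _))] at hjm
    exact hJ.add_varExp hij (by omega) hjm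

theorem GenDegLE.growth_eq_cnt {s : ℕ} (hs : GenDegLE J s) (hJ : StronglyStable J) {t : ℕ}
    (ht : s ≤ t) (i : ℕ) (ht1 : 1 ≤ t) : growth J i t = cnt J i t := by
  rcases Nat.lt_or_ge n i with hlt | hge
  · obtain ⟨t, rfl⟩ := Nat.exists_eq_add_of_le' ht1
    rw [growth_of_lt hlt, cnt_of_lt hlt]
  · rw [growth_eq hge, cnt]
    congr 1
    ext m
    simp only [Set.mem_ofPred_eq]
    refine and_congr_right fun h1 => and_congr_left fun h2 => not_congr ⟨fun h3 => ?_,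
      fun h3 => hJ.1 _ h3 _⟩
    exact hs.mem_of_add_mem hJ hge h2 (by omega) h3

theorem add_varExp_zero_mem (hJ : StronglyStable J) (hsat : monSat J = J) {m : Mon n}
    (h : m + varExp n 0 ∈ J) : m ∈ J := by
  rw [← hsat]
  intro i
  refine ⟨1, ?_⟩
  have h1 := hJ.add_varExp (Nat.zero_le i.val) (by omega) h
  convert h1 using 1
  ext l
  simp only [Pi.add_apply, varExp, Fin.ext_iff]
  split_ifs <;> omega

theorem growth_zero_eq_cnt (hJ : StronglyStable J) (hsat : monSat J = J) (t : ℕ) :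
    growth J 0 t = cnt J 0 t := by
  rw [growth_eq (Nat.zero_le n), cnt]
  congr 1
  ext m
  simp only [Set.mem_ofPred_eq]
  refine and_congr_right fun _ => and_congr_left fun _ => not_congr
    ⟨add_varExp_zero_mem hJ hsat, fun h3 => hJ.1 _ h3 _⟩

theorem hilb_succ (hJ : StronglyStable J) (hsat : monSat J = J) (t : ℕ) :
    hilb J (t + 1) = hilb J t + cnt J 1 (t + 1) := by
  rw [← cnt_zero, ← cnt_zero, growth_add, growth_zero_eq_cnt hJ hsat]

/-- By Dickson's lemma the regularity of a monomial ideal bounds the degrees of its minimal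
generators. -/
theorem genDegLE_monReg (hJ : MonIdeal J) : GenDegLE J (monReg J) := by
  have hac : IsAntichain (· ≤ ·) {m | IsMinGen J m} := by
    intro a ha b hb hab hle
    obtain ⟨i, hi⟩ : ∃ i, a i < b i := by
      by_contra h
      push Not at h
      exact hab (le_antisymm hle h)
    refine hb.2 i (by omega) ?_
    have h1 : shrinkAt b i = a + (shrinkAt b i - a) := by
      ext l
      have : a l ≤ b l := hle l
      simp only [shrinkAt, Pi.add_apply, Pi.sub_apply]
      split_ifs with h
      · subst h; omega
      · omega
    rw [h1]
    exact hJ a ha.1 _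
  have hfin : {m | IsMinGen J m}.Finite := hac.finite_of_wellQuasiOrdered wellQuasiOrdered_le
  intro m hm
  refine le_csSup ((hfin.image mdeg).subset ?_).bddAbove ⟨m, hm, rfl⟩
  rintro d ⟨m, hm, rfl⟩
  exact ⟨m, hm, rfl⟩

theorem GenDegLE.monReg_le {s : ℕ} (h : GenDegLE J s) : monReg J ≤ s := by
  refine csSup_le' ?_
  rintro d ⟨m, hm, rfl⟩
  exact h m hm

end Stable

theorem zchoose_zero (a : ℤ) : zchoose a 0 = 1 := by simp [zchoose]

theorem zchoose_natCast (a k : ℕ) : zchoose a k = a.choose k := by simp [zchoose]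

theorem zchoose_succ (a : ℤ) (k : ℕ) :
    zchoose a (k + 1) = zchoose (a - 1) (k + 1) + zchoose (a - 1) k := by
  rcases lt_trichotomy a 0 with h | rfl | h
  · obtain ⟨b, rfl⟩ : ∃ b : ℕ, a = -(b + 1 : ℤ) := ⟨(-a - 1).toNat, by omega⟩
    have h1 : (((k + 1 : ℕ) : ℤ) - 1 - -(b + 1 : ℤ)).toNat = k + b + 1 := by omega
    have h2 : (((k + 1 : ℕ) : ℤ) - 1 - (-(b + 1 : ℤ) - 1)).toNat = k + b + 2 := by omega
    have h3 : ((k : ℤ) - 1 - (-(b + 1 : ℤ) - 1)).toNat = k + b + 1 := by omega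
    rw [zchoose, zchoose, zchoose, if_neg (by omega), if_neg (by omega), if_neg (by omega),
      h1, h2, h3, Nat.choose_succ_succ (k + b + 1) k]
    push_cast
    ring
  · have h2 : (((k + 1 : ℕ) : ℤ) - 1 - (0 - 1)).toNat = k + 1 := by omega
    have h3 : ((k : ℤ) - 1 - (0 - 1)).toNat = k := by omega
    rw [zchoose, zchoose, zchoose, if_pos le_rfl, if_neg (by omega), if_neg (by omega), h2, h3,
      Nat.choose_self, Nat.choose_self]
    simp [pow_succ]
  · obtain ⟨b, rfl⟩ : ∃ b : ℕ, a = b + 1 := ⟨(a - 1).toNat, by omega⟩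
    rw [add_sub_cancel_right, ← Nat.cast_add_one, zchoose_natCast, zchoose_natCast,
      zchoose_natCast, Nat.choose_succ_succ]
    push_cast
    ring

namespace GotzmannPoly

/-- The `i`-th backward difference of `p`. -/
def diff (p : GotzmannPoly) (i : ℕ) (z : ℤ) : ℤ :=
  ∑ j ∈ Finset.range p.r, if i ≤ p.ks.getD j 0 then
    zchoose (z + (p.ks.getD j 0 : ℤ) - j - i) (p.ks.getD j 0 - i) else 0

theorem diff_zero (p : GotzmannPoly) (z : ℤ) : p.diff 0 z = p.eval z := by
  simp [diff, eval]

theorem diff_succ (p : GotzmannPoly) (i : ℕ) (z : ℤ) :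
    p.diff i z = p.diff i (z - 1) + p.diff (i + 1) z := by
  rw [diff, diff, diff, ← Finset.sum_add_distrib]
  refine Finset.sum_congr rfl fun j _ => ?_
  generalize p.ks.getD j 0 = k
  rcases lt_trichotomy i k with h | rfl | h
  · obtain ⟨d, rfl⟩ := Nat.exists_eq_add_of_lt h
    rw [if_pos (by omega), if_pos (by omega), if_pos (by omega),
      show i + d + 1 - i = d + 1 by omega, show i + d + 1 - (i + 1) = d by omega, zchoose_succ]
    push_cast
    ring_nf
  · simp [zchoose_zero]
  · rw [if_neg (by omega), if_neg (by omega), if_neg (by omega), add_zero]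

theorem diff_eq_zero (p : GotzmannPoly) : ∃ N, ∀ i z, N ≤ i → p.diff i z = 0 := by
  refine ⟨(∑ j ∈ Finset.range p.r, p.ks.getD j 0) + 1, fun i z hi => ?_⟩
  refine Finset.sum_eq_zero fun j hj => if_neg ?_
  have := Finset.single_le_sum (f := fun j => p.ks.getD j 0) (fun _ _ => Nat.zero_le _) hj
  omega

theorem getD_antitone (p : GotzmannPoly) {i j : ℕ} (h : i ≤ j) :
    p.ks.getD j 0 ≤ p.ks.getD i 0 := by
  rcases Nat.lt_or_ge j p.ks.length with hj | hj
  · rw [List.getD_eq_getElem _ _ hj, List.getD_eq_getElem _ _ (h.trans_lt hj)]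
    exact p.sorted.rel_get_of_le (a := ⟨i, h.trans_lt hj⟩) (b := ⟨j, hj⟩) h
  · rw [List.getD_eq_default _ _ hj]
    exact Nat.zero_le _

/-- No polynomial with at least two Gotzmann terms agrees with that of a projective space. -/
theorem exists_diff_one_ne (p : GotzmannPoly) (hr : 1 < p.r) (n : ℕ) :
    ∃ i, p.diff i 1 ≠ (n + 1 - i : ℕ) := by
  by_contra! h
  set k := fun j => p.ks.getD j 0 with hk
  have hanti : ∀ j, k j ≤ k 0 := fun j => p.getD_antitone (Nat.zero_le j)
  have h1 : p.diff (k 0 + 1) 1 = 0 := Finset.sum_eq_zero fun j _ => if_neg (by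
    have := hanti j
    simp only [hk] at this ⊢
    omega)
  have h2 : ((k 0 + 1 - k 1 + 1 : ℕ) : ℤ) ≤ p.diff (k 1) 1 := by
    obtain ⟨r, hr'⟩ := Nat.exists_eq_add_of_le' hr
    obtain ⟨d, hd⟩ := Nat.exists_eq_add_of_le (hanti 1)
    rw [diff, hr', Finset.sum_range_succ', Finset.sum_range_succ']
    have h3 : ∀ j, 0 ≤ if k 1 ≤ k (j + 1 + 1) then
        zchoose (1 + (k (j + 1 + 1) : ℤ) - (j + 1 + 1 : ℕ) - k 1) (k (j + 1 + 1) - k 1) else 0 := by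
      intro j
      split_ifs with h4
      · have : k (j + 1 + 1) - k 1 = 0 := by
          have := p.getD_antitone (show 1 ≤ j + 1 + 1 by omega)
          simp only [hk]
          omega
        rw [this, zchoose_zero]
        exact zero_le_one
      · exact le_rfl
    have h4 : zchoose (1 + (k 0 : ℤ) - (0 : ℕ) - k 1) (k 0 - k 1) = d + 1 := by
      rw [show (1 + (k 0 : ℤ) - (0 : ℕ) - k 1) = ((d + 1 : ℕ) : ℤ) by rw [hd]; push_cast; ring,
        show k 0 - k 1 = d by omega, zchoose_natCast, Nat.choose_succ_self_right]
      push_cast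
      ring
    have h5 := Finset.sum_nonneg fun j (_ : j ∈ Finset.range r) => h3 j
    simp only [hk, zero_add] at h4 h5 hd ⊢
    rw [if_pos le_rfl, if_pos (by omega), h4]
    simp only [Nat.sub_self, zchoose_zero]
    push_cast at h5 ⊢
    omega
  rw [h] at h1 h2
  have h3 : (1 : ℤ) ≤ p.diff (k 0) 1 := by
    obtain ⟨r, hr'⟩ := Nat.exists_eq_add_of_le' hr
    rw [diff, hr', show r + (1 + 1) = r + 1 + 1 by omega, Finset.sum_range_succ',
      if_pos le_rfl, Nat.sub_self, zchoose_zero]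
    have := Finset.sum_nonneg (s := Finset.range (r + 1)) fun j (_ : j ∈ Finset.range (r + 1)) =>
      show 0 ≤ if k 0 ≤ k (j + 1) then
        zchoose (1 + (k (j + 1) : ℤ) - (j + 1 : ℕ) - k 0) (k (j + 1) - k 0) else 0 by
        rw [Nat.sub_eq_zero_of_le (hanti _), zchoose_zero]; split_ifs <;> simp
    simp only [hk] at this ⊢
    omega
  rw [h] at h3
  have := hanti 1
  omega

end GotzmannPoly

theorem eq_zero_of_differences {e : ℕ → ℕ → ℤ} {s N T : ℕ}
    (hrec : ∀ i t, s ≤ t → e i (t + 1) = e i t + e (i + 1) (t + 1))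
    (hN : ∀ i t, N ≤ i → s ≤ t → e i t = 0) (hT : ∀ t, T ≤ t → e 0 t = 0) (i : ℕ) {t : ℕ}
    (ht : s ≤ t) : e i t = 0 := by
  have hev : ∀ i t, max s T + i ≤ t → e i t = 0 := by
    intro i
    induction i with
    | zero => exact fun t ht => hT t (by omega)
    | succ i ih =>
      intro t ht
      obtain ⟨t, rfl⟩ := Nat.exists_eq_add_of_le' (show 1 ≤ t by omega)
      have h1 := hrec i t (by omega)
      rw [ih _ (by omega), ih _ (by omega)] at h1
      omega
  have main : ∀ d i, N ≤ i + d → ∀ t, s ≤ t → e i t = 0 := by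
    intro d
    induction d with
    | zero => exact fun i hi t ht => hN i t hi ht
    | succ d ih =>
      intro i hi t ht
      have hconst : ∀ l, e i (t + l) = e i t := by
        intro l
        induction l with
        | zero => rfl
        | succ l ihl =>
          rw [← add_assoc, hrec i _ (by omega), ihl, ih (i + 1) (by omega) _ (by omega), add_zero]
      rw [← hconst (max s T + i), hev i _ (by omega)]
  exact main N i (by omega) t ht

section Regularity

variable {n : ℕ} {J : Set (Mon n)} {p : GotzmannPoly} {s : ℕ}

theorem GenDegLE.cnt_succ (hs : GenDegLE J s) (hJ : StronglyStable J) (hs1 : 1 ≤ s) (i : ℕ)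
    {t : ℕ} (ht : s ≤ t) : cnt J i (t + 1) = cnt J i t + cnt J (i + 1) (t + 1) := by
  rw [growth_add, hs.growth_eq_cnt hJ ht i (by omega)]

theorem GenDegLE.cnt_eq_diff (hs : GenDegLE J s) (hJ : StronglyStable J) (hs1 : 1 ≤ s)
    (hp : HasHP p fun t => hilb J t) (i : ℕ) {t : ℕ} (ht : s ≤ t) :
    (cnt J i t : ℤ) = p.diff i t := by
  obtain ⟨N, hN⟩ := p.diff_eq_zero
  obtain ⟨T, hT⟩ := hp
  rw [← sub_eq_zero]
  refine eq_zero_of_differences (e := fun i t => (cnt J i t : ℤ) - p.diff i t) (s := s)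
    (N := max (n + 1) N) (T := T) (fun i t ht => ?_) (fun i t hi ht => ?_) (fun t ht => ?_) i ht
  · rw [hs.cnt_succ hJ hs1 i ht, p.diff_succ i]
    push_cast
    ring_nf
  · obtain ⟨t, rfl⟩ := Nat.exists_eq_add_of_le' (show 1 ≤ t by omega)
    rw [cnt_of_lt (by omega), hN i _ (by omega)]
    simp
  · rw [cnt_zero, p.diff_zero]
    exact sub_eq_zero.2 (hT t ht)

/-- The Hilbert function agrees with the Hilbert polynomial from the regularity minus one on. -/
theorem GenDegLE.hilb_eq (hs : GenDegLE J (s + 1)) (hJ : StronglyStable J) (hsat : monSat J = J)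
    (hp : HasHP p fun t => hilb J t) {t : ℕ} (ht : s ≤ t) : (hilb J t : ℤ) = p.eval t := by
  have h1 := hs.cnt_eq_diff hJ (by omega) hp 0 (t := t + 1) (by omega)
  have h2 := hs.cnt_eq_diff hJ (by omega) hp 1 (t := t + 1) (by omega)
  have h3 := p.diff_succ 0 (t + 1 : ℕ)
  rw [cnt_zero, hilb_succ hJ hsat] at h1
  rw [← p.diff_zero]
  push_cast at *
  rw [add_sub_cancel_right] at h3
  omega

theorem GenDegLE.growth_one_eq (hs : GenDegLE J (s + 2)) (hJ : StronglyStable J)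
    (hp : HasHP p fun t => hilb J t) :
    (growth J 1 (s + 1) : ℤ) = p.eval (s + 1 : ℕ) - p.eval s := by
  have h1 := hs.cnt_eq_diff hJ (by omega) hp 1 le_rfl
  have h2 := hs.cnt_eq_diff hJ (by omega) hp 2 le_rfl
  have h3 := p.diff_succ 1 (s + 2 : ℕ)
  have h4 := p.diff_succ 0 (s + 1 : ℕ)
  have h5 := growth_add J 1 (s + 1)
  rw [← p.diff_zero, ← p.diff_zero]
  push_cast at *
  rw [show (s + 2 - 1 : ℤ) = s + 1 by ring] at h3
  rw [add_sub_cancel_right] at h4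
  simp only [add_assoc, show (1 + 1 : ℕ) = 2 from rfl] at *
  omega

theorem eq_zero_of_mdeg {m : Mon n} (h : mdeg m = 0) : m = 0 := by
  ext i
  have := le_mdeg m i
  simp only [Pi.zero_apply]
  omega

theorem cnt_empty_one (n i : ℕ) : cnt (∅ : Set (Mon n)) i 1 = n + 1 - i := by
  obtain ⟨d, hd⟩ : ∃ d, n + 1 - i = d := ⟨_, rfl⟩
  induction d generalizing i with
  | zero => rw [cnt_of_lt (by omega), hd]
  | succ d ih =>
    have h1 : {m : Mon n | mdeg m = 0 ∧ m + varExp n i ∉ (∅ : Set (Mon n)) ∧ StartsAt i m} =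
        {0} := by
      ext m
      simp only [Set.mem_ofPred_eq, Set.mem_singleton_iff, Set.mem_empty_iff_false,
        not_false_eq_true, true_and]
      refine ⟨fun h => eq_zero_of_mdeg h.1, ?_⟩
      rintro rfl
      exact ⟨by simp [mdeg], fun _ _ => rfl⟩
    rw [growth_add, growth_eq (by omega), h1, Set.ncard_singleton, ih (i + 1) (by omega)]
    omega

theorem one_le_monReg (hr : 1 < p.r) (hJ : StronglyStable J)
    (hp : HasHP p fun t => hilb J t) (h0 : hilb J 0 = 1) : 1 ≤ monReg J := by
  have hne : J.Nonempty := by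
    rw [Set.nonempty_iff_ne_empty]
    rintro rfl
    have hs : GenDegLE (∅ : Set (Mon n)) 1 := fun m hm => absurd hm.1 (Set.notMem_empty m)
    obtain ⟨i, hi⟩ := p.exists_diff_one_ne hr n
    have := hs.cnt_eq_diff hJ le_rfl hp i le_rfl
    rw [cnt_empty_one] at this
    exact hi (by simpa using this.symm)
  obtain ⟨m, hm, hmin⟩ : ∃ m ∈ J, ∀ m' ∈ J, mdeg m ≤ mdeg m' := by
    obtain ⟨m, hm⟩ := exists_minimalFor_of_wellFoundedLT (· ∈ J) mdeg hne
    exact ⟨m, hm.1, fun m' hm' => (le_total _ _).elim id fun h => hm.2 hm' h⟩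
  have hgen : IsMinGen J m := by
    refine ⟨hm, fun i hi h => ?_⟩
    have h1 := hmin _ h
    have h2 := mdeg_add_varExp (by omega) (shrinkAt m i) (i := i.val)
    rw [shrinkAt_add_varExp i hi] at h2
    omega
  have h1 := genDegLE_monReg hJ.1 m hgen
  have h2 : mdeg m ≠ 0 := fun h2 => by
    have h3 : {m : Mon n | mdeg m = 0 ∧ m ∉ J} = ∅ := by
      rw [Set.eq_empty_iff_forall_notMem]
      rintro m' ⟨h4, h5⟩
      rw [eq_zero_of_mdeg h4, ← eq_zero_of_mdeg h2] at h5
      exact h5 hm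
    rw [hilb, h3, Set.ncard_empty] at h0
    omega
  omega

end Regularity

section Parts

variable {n : ℕ}

/-- Degree of `m` in the variables `x_k, …, x_n`. -/
def tailDeg (k : ℕ) (m : Mon n) : ℕ := ∑ l : Fin (n + 1), if k ≤ l.val then m l else 0

theorem tailDeg_zero (m : Mon n) : tailDeg 0 m = mdeg m := by simp [tailDeg, mdeg]

theorem tailDeg_add (k : ℕ) (a b : Mon n) : tailDeg k (a + b) = tailDeg k a + tailDeg k b := by
  rw [tailDeg, tailDeg, tailDeg, ← Finset.sum_add_distrib]
  refine Finset.sum_congr rfl fun l _ => ?_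
  split_ifs <;> rfl

theorem tailDeg_varExp {i : ℕ} (hi : i ≤ n) (k : ℕ) :
    tailDeg k (varExp n i) = if k ≤ i then 1 else 0 := by
  rw [tailDeg, Finset.sum_eq_single (⟨i, by omega⟩ : Fin (n + 1))]
  · simp [varExp]
  · intro l _ hl
    have : l.val ≠ i := fun h => hl (Fin.ext h)
    simp [varExp, this]
  · intro h
    exact absurd (Finset.mem_univ _) h

theorem tailDeg_antitone (m : Mon n) : Antitone fun k => tailDeg k m := by
  intro k k' h
  refine Finset.sum_le_sum fun l _ => ?_
  split_ifs <;> omega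

theorem tailDeg_of_lt {k : ℕ} (hk : n < k) (m : Mon n) : tailDeg k m = 0 :=
  Finset.sum_eq_zero fun l _ => if_neg (by omega)

theorem tailDeg_eq_add (m : Mon n) (l : Fin (n + 1)) :
    tailDeg l m = m l + tailDeg (l + 1) m := by
  rw [tailDeg, tailDeg, ← Finset.add_sum_erase _ _ (Finset.mem_univ l),
    ← Finset.add_sum_erase (s := Finset.univ)
      (f := fun i : Fin (n + 1) => if l.val + 1 ≤ i.val then m i else 0) (Finset.mem_univ l)]
  simp only [le_refl, if_true, Nat.not_succ_le_self, if_false, zero_add]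
  congr 1
  refine Finset.sum_congr rfl fun i hi => ?_
  have h1 : i.val ≠ l.val := fun h => (Finset.mem_erase.1 hi).1 (Fin.ext h)
  split_ifs <;> omega

theorem StartsAt.tailDeg_eq {k : ℕ} {m : Mon n} (h : StartsAt k m) : tailDeg k m = mdeg m := by
  refine Finset.sum_congr rfl fun l _ => ?_
  split_ifs with h1
  · rfl
  · exact (h l (by omega)).symm

theorem ext_tailDeg {a b : Mon n} {k : ℕ} (ha : StartsAt k a) (hb : StartsAt k b)
    (h : ∀ i, k ≤ i → tailDeg i a = tailDeg i b) : a = b := by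
  ext l
  rcases Nat.lt_or_ge l.val k with h1 | h1
  · rw [ha l h1, hb l h1]
  · have h2 := tailDeg_eq_add a l
    rw [h _ h1, h _ (by omega), tailDeg_eq_add b l] at h2
    omega

/-- The indices (in decreasing order) of the variables different from `x_0` of which `m` is the
product. -/
def parts (m : Mon n) (j : ℕ) : ℕ := ((Finset.Icc 1 n).filter fun k => j < tailDeg k m).card

theorem le_parts_iff {m : Mon n} {j k : ℕ} (hk : 1 ≤ k) : k ≤ parts m j ↔ j < tailDeg k m := by
  have hsub : ∀ k, j < tailDeg k m → Finset.Icc 1 k ⊆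
      (Finset.Icc 1 n).filter fun k => j < tailDeg k m := by
    intro k h i hi
    rw [Finset.mem_Icc] at hi
    rw [Finset.mem_filter, Finset.mem_Icc]
    have h1 : j < tailDeg i m := h.trans_le (tailDeg_antitone m hi.2)
    refine ⟨⟨hi.1, ?_⟩, h1⟩
    by_contra hlt
    rw [tailDeg_of_lt (by omega)] at h1
    omega
  constructor
  · intro h
    by_contra hlt
    have h1 : ((Finset.Icc 1 n).filter fun k => j < tailDeg k m) ⊆ Finset.Icc 1 (k - 1) := by
      intro i hi
      rw [Finset.mem_filter, Finset.mem_Icc] at hi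
      rw [Finset.mem_Icc]
      refine ⟨hi.1.1, ?_⟩
      by_contra h2
      exact hlt (hi.2.trans_le (tailDeg_antitone m (by omega)))
    have h2 := Finset.card_le_card h1
    rw [Nat.card_Icc] at h2
    rw [parts] at h
    omega
  · intro h
    have h2 := Finset.card_le_card (hsub k h)
    rw [Nat.card_Icc] at h2
    rw [parts]
    omega

theorem parts_mono {a b : Mon n} (h : ∀ k, 1 ≤ k → tailDeg k a ≤ tailDeg k b) (j : ℕ) :
    parts a j ≤ parts b j := by
  rcases Nat.eq_zero_or_pos (parts a j) with h0 | h0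
  · omega
  · exact (le_parts_iff h0).2 (((le_parts_iff h0).1 le_rfl).trans_le (h _ h0))

/-- `x` is a nonincreasing sequence with exactly `t` positive entries. -/
def IsParts (t : ℕ) (x : ℕ → ℕ) : Prop := Antitone x ∧ ∀ j, 1 ≤ x j ↔ j < t

theorem isParts_parts (m : Mon n) : IsParts (tailDeg 1 m) (parts m) :=
  ⟨fun i j hij => by
    rcases Nat.eq_zero_or_pos (parts m j) with h0 | h0
    · omega
    · exact (le_parts_iff h0).2 (hij.trans_lt ((le_parts_iff h0).1 le_rfl)),
    fun _ => le_parts_iff le_rfl⟩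

theorem StartsAt.le_parts {k : ℕ} {m : Mon n} (h : StartsAt k m) {j : ℕ} (hj : j < mdeg m) :
    k ≤ parts m j := by
  rcases Nat.eq_zero_or_pos k with rfl | hk
  · exact Nat.zero_le _
  · rwa [le_parts_iff hk, h.tailDeg_eq]

theorem StartsAt.parts_add_varExp {i : ℕ} {m : Mon n} (h : StartsAt i m) (hi : i ≤ n) {j : ℕ}
    (hj : j < mdeg m) : parts (m + varExp n i) j = parts m j := by
  refine le_antisymm ?_ (parts_mono (fun k _ => by rw [tailDeg_add]; omega) j)
  rcases Nat.eq_zero_or_pos (parts (m + varExp n i) j) with h0 | h0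
  · omega
  · rw [le_parts_iff h0]
    have h1 := (le_parts_iff h0).1 le_rfl
    rw [tailDeg_add, tailDeg_varExp hi] at h1
    split_ifs at h1 with h2
    · exact hj.trans_le (h.tailDeg_eq.ge.trans (tailDeg_antitone m h2))
    · exact h1

theorem StartsAt.parts_add_varExp_last {i : ℕ} {m : Mon n} (h : StartsAt i m) (hi : i ≤ n)
    (hi1 : 1 ≤ i) : parts (m + varExp n i) (mdeg m) = i := by
  refine le_antisymm ?_ ?_
  · by_contra hlt
    have h0 : 1 ≤ parts (m + varExp n i) (mdeg m) := by omega
    have h1 := (le_parts_iff h0).1 le_rfl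
    rw [tailDeg_add, tailDeg_varExp hi, if_neg (by omega)] at h1
    have h2 : _ ≤ tailDeg 0 m := tailDeg_antitone m (Nat.zero_le (parts (m + varExp n i) (mdeg m)))
    rw [tailDeg_zero] at h2
    simp only at h2
    omega
  · rw [le_parts_iff hi1, tailDeg_add, tailDeg_varExp hi, h.tailDeg_eq]
    simp

theorem exists_parts_eq {t k : ℕ} (hk : 1 ≤ k) {x : ℕ → ℕ} (hx : Antitone x)
    (hn : ∀ j < t, x j + k ≤ n) :
    ∃ m : Mon n, mdeg m = t ∧ StartsAt k m ∧ ∀ j < t, parts m j = x j + k := by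
  let m : Mon n := fun l => ((Finset.range t).filter fun j => x j + k = l.val).card
  have htail : ∀ i, tailDeg i m = ((Finset.range t).filter fun j => i ≤ x j + k).card := by
    intro i
    have h1 : ∀ l : Fin (n + 1), (if i ≤ l.val then m l else 0) =
        ∑ j ∈ Finset.range t, if i ≤ l.val ∧ x j + k = l.val then 1 else 0 := fun l => by
      by_cases h : i ≤ l.val <;> simp [h, m]
    rw [tailDeg, Finset.sum_congr rfl fun l _ => h1 l, Finset.sum_comm, Finset.card_filter]
    refine Finset.sum_congr rfl fun j hj => ?_
    have hj' := hn j (Finset.mem_range.1 hj)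
    rw [Finset.sum_eq_single (⟨x j + k, by omega⟩ : Fin (n + 1))]
    · simp
    · intro l _ hl
      have : x j + k ≠ l.val := fun h => hl (Fin.ext h.symm)
      simp [this]
    · intro h
      exact absurd (Finset.mem_univ _) h
  have hlt : ∀ i j, j < tailDeg i m ↔ j < t ∧ i ≤ x j + k := by
    intro i j
    rw [htail]
    constructor
    · intro h
      by_contra hc
      have hsub : ((Finset.range t).filter fun j => i ≤ x j + k) ⊆ Finset.range j := by
        intro l hl
        rw [Finset.mem_filter, Finset.mem_range] at hl
        rw [Finset.mem_range]
        by_contra hlj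
        have := hx (show j ≤ l by omega)
        exact hc ⟨by omega, by omega⟩
      have := Finset.card_le_card hsub
      rw [Finset.card_range] at this
      omega
    · rintro ⟨h1, h2⟩
      have hsub : Finset.range (j + 1) ⊆ ((Finset.range t).filter fun j => i ≤ x j + k) := by
        intro l hl
        rw [Finset.mem_range] at hl
        rw [Finset.mem_filter, Finset.mem_range]
        have := hx (show l ≤ j by omega)
        exact ⟨by omega, by omega⟩
      have := Finset.card_le_card hsub
      rw [Finset.card_range] at this
      omega
  refine ⟨m, ?_, ?_, fun j hj => ?_⟩
  · rw [← tailDeg_zero, htail]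
    simp
  · intro l hl
    simp only [m, Finset.card_eq_zero, Finset.filter_eq_empty_iff]
    intro j _
    omega
  · have h0 : 1 ≤ parts m j := (le_parts_iff le_rfl).2 ((hlt _ _).2 ⟨hj, by omega⟩)
    refine le_antisymm ?_ ((le_parts_iff (by omega)).2 ((hlt _ _).2 ⟨hj, le_rfl⟩))
    exact ((hlt _ _).1 ((le_parts_iff h0).1 le_rfl)).2

theorem ncard_rank_lt {t k a : ℕ} (hk : 1 ≤ k) (ha : t = 0 → a ≤ 1)
    (hn : ∀ x, Antitone x → rank t x < a → 1 ≤ t → x 0 + k ≤ n) :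
    {m : Mon n | mdeg m = t ∧ rank t (fun j => parts m j - k) < a ∧ StartsAt k m}.ncard = a := by
  have hcard : (Set.Iio a).ncard = a := by simp
  refine Eq.trans ?_ hcard
  refine Set.ncard_congr (fun m _ => rank t fun j => parts m j - k) (fun m hm => hm.2.1) ?_ ?_
  · rintro m m' ⟨h1, h2, h3⟩ ⟨h1', h2', h3'⟩ h
    have hp := rank_inj t (antitone_sub (isParts_parts m).1 k)
      (antitone_sub (isParts_parts m').1 k) h
    have hp' : ∀ j, parts m j = parts m' j := by
      intro j
      rcases Nat.lt_or_ge j t with hj | hj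
      · have h4 := hp j hj
        have h5 := h3.le_parts (h1.symm ▸ hj)
        have h6 := h3'.le_parts (h1'.symm ▸ hj)
        omega
      · have h4 := (isParts_parts m).2 j
        have h5 := (isParts_parts m').2 j
        rw [(h3.mono hk).tailDeg_eq] at h4
        rw [(h3'.mono hk).tailDeg_eq] at h5
        omega
    refine ext_tailDeg h3 h3' fun i hi => ?_
    refine eq_of_forall_lt_iff fun j => ?_
    rw [← le_parts_iff (by omega), ← le_parts_iff (by omega), hp']
  · intro b hb
    rw [Set.mem_Iio] at hb
    obtain ⟨x, hx, hxb⟩ : ∃ x, Antitone x ∧ rank t x = b := by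
      rcases t with _ | t
      · have := ha rfl
        exact ⟨fun _ => 0, antitone_const, by simp only [rank]; omega⟩
      · obtain ⟨x, hx, -, hxb⟩ := exists_rank_eq t b
        exact ⟨x, hx, hxb⟩
    obtain ⟨m, h1, h2, h3⟩ := exists_parts_eq (n := n) (t := t) hk hx fun j hj => by
      have := hn x hx (hxb ▸ hb) (by omega)
      have := hx (Nat.zero_le j)
      omega
    have h4 : rank t (fun j => parts m j - k) = b := by
      rw [← hxb]
      exact rank_congr t fun j hj => by rw [h3 j hj]; omega
    exact ⟨m, ⟨h1, h4 ▸ hb, h2⟩, h4⟩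

end Parts

/-- `P` passes to shorter and termwise smaller sequences. -/
def PartsClosed (P : ℕ → (ℕ → ℕ) → Prop) : Prop :=
  ∀ t t' x x', IsParts t x → IsParts t' x' → t' ≤ t → (∀ j, x' j ≤ x j) → P t x → P t' x'

theorem partsClosed_of {P : ℕ → (ℕ → ℕ) → Prop}
    (hsame : ∀ t x x', IsParts t x → IsParts t x' → (∀ j, x' j ≤ x j) → P t x → P t x')
    (hdrop : ∀ t x x', IsParts (t + 1) x → IsParts t x' → (∀ j < t, x' j = x j) →
      P (t + 1) x → P t x') : PartsClosed P := by
  intro t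
  induction t with
  | zero =>
    intro t' x x' hx hx' ht hle hP
    obtain rfl : t' = 0 := by omega
    exact hsame _ _ _ hx hx' hle hP
  | succ t ih =>
    intro t' x x' hx hx' ht hle hP
    rcases Nat.eq_or_lt_of_le ht with rfl | hlt
    · exact hsame _ _ _ hx hx' hle hP
    have hy : IsParts t fun j => if j < t then x j else 0 := by
      refine ⟨fun i j hij => ?_, fun j => ?_⟩
      · have := hx.1 hij
        dsimp only
        split_ifs <;> omega
      · have := hx.2 j
        dsimp only
        split_ifs <;> omega
    refine ih t' _ x' hy hx' (by omega) (fun j => ?_)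
      (hdrop t x _ hx hy (fun j hj => if_pos hj) hP)
    have h1 := hle j
    have h2 := hx'.2 j
    split_ifs <;> omega

/-- The monomials whose sequence of indices does not satisfy `P`. -/
def partsIdeal (n : ℕ) (P : ℕ → (ℕ → ℕ) → Prop) : Set (Mon n) := {m | ¬ P (tailDeg 1 m) (parts m)}

section PartsIdeal

variable {n : ℕ} {P : ℕ → (ℕ → ℕ) → Prop}

theorem mem_partsIdeal {m : Mon n} : m ∈ partsIdeal n P ↔ ¬ P (tailDeg 1 m) (parts m) := Iff.rfl

theorem PartsClosed.mem_of_le (hP : PartsClosed P) {a b : Mon n}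
    (h : ∀ k, 1 ≤ k → tailDeg k a ≤ tailDeg k b) (ha : a ∈ partsIdeal n P) :
    b ∈ partsIdeal n P :=
  fun hb => ha (hP _ _ _ _ (isParts_parts b) (isParts_parts a) (h 1 le_rfl) (parts_mono h) hb)

theorem PartsClosed.stronglyStable (hP : PartsClosed P) : StronglyStable (partsIdeal n P) := by
  refine ⟨fun m hm m' => hP.mem_of_le (fun k _ => by rw [tailDeg_add]; omega) hm,
    fun m hm j i hji hj => hP.mem_of_le (fun k _ => ?_) hm⟩
  have h1 : borelStep m j i = shrinkAt m j + varExp n i := by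
    ext l
    have : j.val < i.val := hji
    simp only [borelStep, shrinkAt, Pi.add_apply, varExp, Fin.ext_iff]
    split_ifs <;> omega
  have h2 := congrArg (tailDeg k) (shrinkAt_add_varExp j hj)
  rw [h1, ← h2, tailDeg_add, tailDeg_add, tailDeg_varExp (by omega), tailDeg_varExp (by omega)]
  have : j.val < i.val := hji
  split_ifs <;> omega

theorem PartsClosed.monSat_eq (hP : PartsClosed P) : monSat (partsIdeal n P) = partsIdeal n P := by
  refine Set.Subset.antisymm (fun m hm => ?_) fun m hm i => ⟨0, by simpa using hm⟩
  obtain ⟨k, hk⟩ := hm 0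
  refine hP.mem_of_le (fun i hi => le_of_eq ?_) hk
  refine Finset.sum_congr rfl fun l _ => ?_
  by_cases h2 : l = 0
  · subst h2
    rw [if_neg (by simp; omega), if_neg (by simp; omega)]
  · simp only [if_neg h2]

theorem cnt_partsIdeal {t a : ℕ} (hP : ∀ x, P t x ↔ rank t (fun j => x j - 1) < a)
    (ha : t = 0 → a ≤ 1) (hn : ∀ x, Antitone x → rank t x < a → 1 ≤ t → x 0 + 1 ≤ n) :
    cnt (partsIdeal n P) 1 t = a := by
  rw [← ncard_rank_lt le_rfl ha hn, cnt]
  congr 1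
  ext m
  simp only [Set.mem_ofPred_eq]
  refine and_congr_right fun h1 => and_congr_left fun h2 => ?_
  rw [mem_partsIdeal, not_not, h2.tailDeg_eq, h1, hP]

theorem growth_partsIdeal {t i a : ℕ} (hi : i ≤ n) (hi1 : 1 ≤ i)
    (hP : ∀ x, x t = i → (P (t + 1) x ↔ rank t (fun j => x j - i) < a))
    (ha : t = 0 → a ≤ 1) (hn : ∀ x, Antitone x → rank t x < a → 1 ≤ t → x 0 + i ≤ n) :
    growth (partsIdeal n P) i t = a := by
  rw [growth_eq hi, ← ncard_rank_lt hi1 ha hn]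
  congr 1
  ext m
  simp only [Set.mem_ofPred_eq]
  refine and_congr_right fun h1 => and_congr_left fun h2 => ?_
  rw [mem_partsIdeal, not_not, tailDeg_add, tailDeg_varExp hi, if_pos hi1, (h2.mono hi1).tailDeg_eq,
    h1, hP _ (h1 ▸ h2.parts_add_varExp_last hi hi1)]
  rw [rank_congr t fun j hj => by rw [h2.parts_add_varExp hi (h1.symm ▸ hj)]]

theorem genDegLE_partsIdeal {s : ℕ} (hP : PartsClosed P)
    (h : ∀ t x x', s ≤ t → (∀ j < s, x j = x' j) → P t x → P (t + 1) x') :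
    GenDegLE (partsIdeal n P) s := by
  intro m hm
  by_contra hlt
  obtain ⟨i, hi, hst⟩ : ∃ i : Fin (n + 1), m i ≠ 0 ∧ StartsAt i m := by
    have hne : ∃ k, ∃ hk : k < n + 1, m ⟨k, hk⟩ ≠ 0 := by
      by_contra! h0
      have : mdeg m = 0 := Finset.sum_eq_zero fun i _ => h0 i.val i.isLt
      omega
    obtain ⟨hk, hk0⟩ := Nat.find_spec hne
    refine ⟨⟨Nat.find hne, hk⟩, hk0, fun j hj => ?_⟩
    by_contra h0
    exact Nat.find_min hne hj ⟨j.isLt, h0⟩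
  have hsh := shrinkAt_add_varExp i (Nat.one_le_iff_ne_zero.2 hi)
  have hw := hm.2 i (Nat.one_le_iff_ne_zero.2 hi)
  have hmem := hm.1
  generalize shrinkAt m i = w at hsh hw
  subst hsh
  rw [mdeg_add_varExp (by omega)] at hlt
  rcases Nat.eq_zero_or_pos i.val with h0 | h0
  · rw [h0] at hmem
    exact hw (add_varExp_zero_mem hP.stronglyStable hP.monSat_eq hmem)
  · replace h0 : 1 ≤ i.val := h0
    have hstw := (startsAt_add.1 hst).1
    rw [mem_partsIdeal, not_not] at hw
    refine hmem ?_
    rw [tailDeg_add, tailDeg_varExp (by omega), if_pos h0]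
    have ht := (hstw.mono h0).tailDeg_eq
    refine h _ _ _ (by omega) (fun j hj => ?_) hw
    rw [hstw.parts_add_varExp (by omega) (by omega)]

end PartsIdeal

section Construction

variable {h d : ℕ → ℕ} {S : ℕ}

theorem head_lt_of_rank_lt (hh : ∀ t, minusMinus (h (t + 1)) (t + 1) ≤ h t) (t : ℕ) {x : ℕ → ℕ}
    (hx : Antitone x) (hr : rank (t + 1) x < h (t + 1)) : x 0 < h 1 := by
  induction t with
  | zero => exact (head_le_rank 0 x).trans_lt hr
  | succ t ih => exact ih ((rank_lt_minusMinus hx hr).trans_le (hh (t + 1)))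

/-- The lex condition associated with the function `h`. -/
def lexPred (h : ℕ → ℕ) (t : ℕ) (x : ℕ → ℕ) : Prop := rank t (fun j => x j - 1) < h t

theorem partsClosed_lexPred (hh : ∀ t, minusMinus (h (t + 1)) (t + 1) ≤ h t) :
    PartsClosed (lexPred h) := by
  refine partsClosed_of (fun t x x' _ _ hle hx => ?_) fun t x x' hx _ he hP => ?_
  · exact (rank_mono t fun j _ => Nat.sub_le_sub_right (hle j) 1).trans_lt hx
  · rw [lexPred, rank_congr t fun j hj => by rw [he j hj]]
    exact (rank_lt_minusMinus (antitone_sub hx.1 1) hP).trans_le (hh t)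

/-- The growth-lexicographic condition: lex with function `h` up to degree `S`, and with
prescribed growth `d` from degree `S` to degree `S + 1`. -/
def growthLexPred (h d : ℕ → ℕ) (S t : ℕ) (x : ℕ → ℕ) : Prop :=
  if t ≤ S then rank t (fun j => x j - 1) < h t else rank S (fun j => x j - x S) < d (x S)

theorem rank_sub_lt_of_le (hd : ∀ i, minusMinus (d i) S + d (i + 1) ≤ d i) {x : ℕ → ℕ}
    (hx : Antitone x) {i k : ℕ} (hik : i ≤ k) (hr : rank S (fun j => x j - k) < d k) :
    rank S (fun j => x j - i) < d i := by
  induction k, hik using Nat.le_induction with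
  | base => exact hr
  | succ k hk ih =>
    refine ih (rank_lt_of_lt_sub (antitone_sub hx k) ?_)
    have := hd k
    simp only [Nat.sub_sub]
    omega

theorem partsClosed_growthLexPred (hh : ∀ t, minusMinus (h (t + 1)) (t + 1) ≤ h t)
    (hd : ∀ i, minusMinus (d i) S + d (i + 1) ≤ d i) (hdh : d 1 ≤ h S) :
    PartsClosed (growthLexPred h d S) := by
  refine partsClosed_of (fun t x x' hx hx' hle hP => ?_) fun t x x' hx hx' he hP => ?_
  · by_cases ht : t ≤ S
    · rw [growthLexPred, if_pos ht] at hP ⊢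
      exact (rank_mono t fun j _ => Nat.sub_le_sub_right (hle j) 1).trans_lt hP
    · rw [growthLexPred, if_neg ht] at hP ⊢
      exact (rank_mono S fun j _ => Nat.sub_le_sub_right (hle j) (x' S)).trans_lt
        (rank_sub_lt_of_le hd hx.1 (hle S) hP)
  · rcases lt_trichotomy t S with ht | rfl | ht
    · rw [growthLexPred, if_pos (by omega)] at hP ⊢
      rw [rank_congr t fun j hj => by rw [he j hj]]
      exact (rank_lt_minusMinus (antitone_sub hx.1 1) hP).trans_le (hh t)
    · rw [growthLexPred, if_neg (by omega)] at hP
      rw [growthLexPred, if_pos le_rfl, rank_congr t fun j hj => by rw [he j hj]]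
      exact (rank_sub_lt_of_le hd hx.1 ((hx.2 t).2 (by omega)) hP).trans_le hdh
    · rw [growthLexPred, if_neg (by omega)] at hP ⊢
      rwa [he S ht, rank_congr S fun j hj => by rw [he j (by omega)]]

theorem exists_lex_ideal (hh : ∀ t, minusMinus (h (t + 1)) (t + 1) ≤ h t) (h0 : h 0 = 1) :
    ∃ (n : ℕ) (J : Set (Mon n)), StronglyStable J ∧ monSat J = J ∧ ∀ t, cnt J 1 t = h t := by
  have hP := partsClosed_lexPred hh
  refine ⟨h 1, partsIdeal (h 1) (lexPred h), hP.stronglyStable, hP.monSat_eq,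
    fun t => cnt_partsIdeal (fun x => Iff.rfl) (fun ht => by rw [ht, h0]) ?_⟩
  intro x hx hr ht
  obtain ⟨t, rfl⟩ := Nat.exists_eq_add_of_le' ht
  exact head_lt_of_rank_lt hh t hx hr

theorem exists_growthLex_ideal (hh : ∀ t, minusMinus (h (t + 1)) (t + 1) ≤ h t) (h0 : h 0 = 1)
    (hd : ∀ i, minusMinus (d i) S + d (i + 1) ≤ d i) (hdh : d 1 ≤ h S) {n : ℕ}
    (hdn : ∀ i, n < i → d i = 0) :
    ∃ (n' : ℕ) (J : Set (Mon n')), StronglyStable J ∧ monSat J = J ∧ GenDegLE J (S + 1) ∧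
      (∀ t ≤ S, cnt J 1 t = h t) ∧ ∀ i, 1 ≤ i → growth J i S = d i := by
  have hP := partsClosed_growthLexPred hh hd hdh
  have hd1 : ∀ i, 1 ≤ i → d i ≤ d 1 := fun i hi => by
    induction i, hi using Nat.le_induction with
    | base => exact le_rfl
    | succ i _ ih =>
      have := hd i
      omega
  refine ⟨n + h 1 + d 1, partsIdeal _ (growthLexPred h d S), hP.stronglyStable, hP.monSat_eq,
    genDegLE_partsIdeal hP ?_, fun t ht => cnt_partsIdeal (fun x => ?_)
      (fun ht => by rw [ht, h0]) ?_, fun i hi => ?_⟩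
  · intro t x x' ht he hx
    rw [growthLexPred, if_neg (by omega)] at hx ⊢
    rwa [← he S (by omega), rank_congr S fun j hj => by rw [← he j (by omega)]]
  · rw [growthLexPred, if_pos ht]
  · intro x hx hr ht
    obtain ⟨t, rfl⟩ := Nat.exists_eq_add_of_le' ht
    have := head_lt_of_rank_lt hh t hx hr
    omega
  · rcases Nat.lt_or_ge (n + h 1 + d 1) i with hlt | hge
    · rw [growth_of_lt hlt, hdn i (by omega)]
    · refine growth_partsIdeal hge hi (fun x hx => ?_) (fun hS => ?_) fun x hx hr hS => ?_
      · rw [growthLexPred, if_neg (by omega), hx]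
      · have := hd1 i hi
        rw [hS, h0] at hdh
        omega
      · obtain ⟨S, rfl⟩ := Nat.exists_eq_add_of_le' hS
        have h1 := head_le_rank S x
        have h2 := hd1 i hi
        have h3 : i ≤ n := by
          by_contra hlt
          rw [hdn i (by omega)] at hr
          omega
        omega

end Construction

section HilbertFunction

variable {n : ℕ} {J : Set (Mon n)} {p : GotzmannPoly} {ρ ρ' S s : ℕ} {u u' : ℕ → ℤ}

theorem hilb_zero (J : Set (Mon n)) : hilb J 0 = cnt J 1 0 := by
  rw [hilb, cnt]
  congr 1
  ext m
  refine and_congr_right fun h => (and_iff_left ?_).symm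
  rw [eq_zero_of_mdeg h]
  exact fun _ _ => rfl

theorem hilb_eq_of_cnt (hJ : StronglyStable J) (hsat : monSat J = J) (h0 : (cnt J 1 0 : ℤ) = u 0)
    (h : ∀ t, (cnt J 1 (t + 1) : ℤ) = nderiv u (t + 1)) (t : ℕ) : (hilb J t : ℤ) = u t := by
  induction t with
  | zero => rw [hilb_zero, h0]
  | succ t ih =>
    have := h t
    rw [nderiv] at this
    rw [hilb_succ hJ hsat]
    push_cast
    omega

theorem OSeq.toNat_minusMinus_le {H : ℕ → ℤ} (hH : OSeq H) (t : ℕ) :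
    minusMinus (H (t + 1)).toNat (t + 1) ≤ (H t).toNat := by
  have := hH.minusMinus_le t
  omega

theorem exists_monReg_eq_mReg (hu : u ∈ Fset p ρ) :
    ∃ (n : ℕ) (J : Set (Mon n)), StronglyStable J ∧ monSat J = J ∧
      (∀ t : ℕ, (hilb J t : ℤ) = u t) ∧ monReg J = mReg u := by
  refine Nat.sInf_mem (s := {r | ∃ (n : ℕ) (J : Set (Mon n)), StronglyStable J ∧ monSat J = J ∧
    (∀ t : ℕ, (hilb J t : ℤ) = u t) ∧ monReg J = r}) ?_
  obtain ⟨n, J, hJ, hsat, hc⟩ := exists_lex_ideal (h := fun t => (nderiv u t).toNat)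
    hu.2.1.toNat_minusMinus_le rfl
  refine ⟨monReg J, n, J, hJ, hsat, hilb_eq_of_cnt hJ hsat ?_ fun t => ?_, rfl⟩
  · rw [hc, hu.1.2.1]; rfl
  · rw [hc, Int.toNat_of_nonneg (hu.2.1.1 _)]

theorem mReg_le (hJ : StronglyStable J) (hsat : monSat J = J) (h : ∀ t : ℕ, (hilb J t : ℤ) = u t)
    (hs : GenDegLE J s) : mReg u ≤ s :=
  le_trans (show mReg u ≤ monReg J from Nat.sInf_le ⟨n, J, hJ, hsat, h, rfl⟩) hs.monReg_le

theorem GenDegLE.mono {s' : ℕ} (hs : GenDegLE J s) (h : s ≤ s') : GenDegLE J s' :=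
  fun m hm => (hs m hm).trans h

theorem hasHP_hilb (hu : u ∈ Fset p ρ) (h : ∀ t : ℕ, (hilb J t : ℤ) = u t) :
    HasHP p fun t => hilb J t :=
  ⟨ρ, fun t ht => (h t).trans (hu.2.2.1 t ht)⟩

theorem exists_genDegLE_mReg (hr : 1 < p.r) (hu : u ∈ Fset p ρ) : 1 ≤ mReg u ∧
    ∃ (n : ℕ) (J : Set (Mon n)), StronglyStable J ∧ monSat J = J ∧
      (∀ t : ℕ, (hilb J t : ℤ) = u t) ∧ GenDegLE J (mReg u) := by
  obtain ⟨n, J, hJ, hsat, h, hm⟩ := exists_monReg_eq_mReg hu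
  refine ⟨hm ▸ one_le_monReg hr hJ (hasHP_hilb hu h) ?_, n, J, hJ, hsat, h,
    hm ▸ genDegLE_monReg hJ.1⟩
  have h0 := h 0
  rw [hu.1.2.1] at h0
  exact_mod_cast h0

theorem lt_mReg (hr : 1 < p.r) (hu : u ∈ Fset p ρ) : ρ + 1 ≤ mReg u := by
  obtain ⟨h1, n, J, hJ, hsat, h, hs⟩ := exists_genDegLE_mReg hr hu
  obtain ⟨s, hsm⟩ := Nat.exists_eq_add_of_le' h1
  rw [hsm] at hs ⊢
  exact Nat.succ_le_succ (hu.2.2.2 s fun t ht => by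
    rw [← h, hs.hilb_eq hJ hsat (hasHP_hilb hu h) ht])

theorem le_eval_of_mReg (hr : 1 < p.r) {k : ℕ} (hu : u ∈ Fset p (k + 1))
    (hm : mReg u = k + 1 + 1) : u k ≤ p.eval k := by
  obtain ⟨-, n, J, hJ, hsat, h, hs⟩ := exists_genDegLE_mReg hr hu
  rw [hm] at hs
  have h1 := hs.growth_one_eq hJ (hasHP_hilb hu h)
  have h2 := growth_le_cnt hJ.1 1 (k + 1)
  have h3 := hilb_succ hJ hsat k
  have h4 := h k
  have h5 := h (k + 1)
  have h6 := hu.2.2.1 (k + 1) le_rfl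
  omega

/-- An ideal generated in degrees at most `S + 1` can be replaced by one with the same Hilbert
polynomial and Hilbert function `u`, without exceeding this bound. -/
theorem mReg_le_succ (hr : 1 < p.r) (hu : u ∈ Fset p ρ) (hu' : u' ∈ Fset p ρ')
    (hm : mReg u' ≤ S + 1) (hρ : ρ ≤ S) (hK : ∀ k, S = k + 1 → u k ≤ p.eval k) :
    mReg u ≤ S + 1 := by
  obtain ⟨-, n, J, hJ, hsat, h, hs⟩ := exists_genDegLE_mReg hr hu'
  replace hs := hs.mono hm
  have hp := hasHP_hilb hu' h
  have hdh : growth J 1 S ≤ (nderiv u S).toNat := by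
    rcases S with _ | k
    · have h1 := growth_le_cnt hJ.1 1 0
      rw [← hilb_zero] at h1
      have h2 := h 0
      rw [hu'.1.2.1] at h2
      simp only [nderiv]
      omega
    · have h1 := hs.growth_one_eq hJ hp
      have h2 := hK k rfl
      have h3 := hu.2.2.1 (k + 1) hρ
      simp only [nderiv]
      omega
  obtain ⟨n', J', hJ', hsat', hs', hlow, hgr⟩ :=
    exists_growthLex_ideal (h := fun t => (nderiv u t).toNat) (d := fun i => growth J i S)
      hu.2.1.toNat_minusMinus_le rfl (fun i => macaulay_growth hJ i S) hdh
      (fun i hi => growth_of_lt hi)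
  have hcnt : ∀ t, ∀ i, 1 ≤ i → cnt J' i (S + 1 + t) = cnt J i (S + 1 + t) := by
    have hind : ∀ t, (∀ i, 1 ≤ i → growth J' i (S + t) = growth J i (S + t)) →
        ∀ i, 1 ≤ i → cnt J' i (S + t + 1) = cnt J i (S + t + 1) := by
      intro t ht i hi
      obtain ⟨N, hN⟩ : ∃ N, n + n' + 1 ≤ i + N := ⟨n + n' + 1, by omega⟩
      induction N generalizing i with
      | zero => rw [cnt_of_lt (by omega), cnt_of_lt (by omega)]
      | succ N ih => rw [growth_add J', growth_add J, ht i hi, ih (i + 1) (by omega) (by omega)]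
    intro t
    induction t with
    | zero => exact hind 0 hgr
    | succ t ih =>
      have := hind (t + 1) fun i hi => by
        rw [hs'.growth_eq_cnt hJ' (by omega) i (by omega),
          hs.growth_eq_cnt hJ (by omega) i (by omega), show S + (t + 1) = S + 1 + t by omega,
          ih i hi]
      rwa [show S + 1 + (t + 1) = S + (t + 1) + 1 by omega]
  refine mReg_le hJ' hsat' (hilb_eq_of_cnt hJ' hsat' ?_ fun t => ?_) hs'
  · rw [hlow 0 (Nat.zero_le S), hu.1.2.1]; rfl
  · rcases Nat.lt_or_ge t S with ht | ht
    · rw [hlow (t + 1) ht, Int.toNat_of_nonneg (hu.2.1.1 _)]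
    · obtain ⟨l, rfl⟩ := Nat.exists_eq_add_of_le ht
      have h1 := hcnt l 1 le_rfl
      rw [show S + 1 + l = S + l + 1 by omega] at h1
      have h2 := hilb_succ hJ hsat (S + l)
      have h3 := hs.hilb_eq hJ hsat hp (t := S + l) (by omega)
      have h4 := hs.hilb_eq hJ hsat hp (t := S + l + 1) (by omega)
      have h5 := hu.2.2.1 (S + l) (by omega)
      have h6 := hu.2.2.1 (S + l + 1) (by omega)
      rw [nderiv]
      omega

theorem fmin_rhobar_mem (hne : (Fset p ρ).Nonempty) :
    rhobar p ≤ ρ ∧ fmin p (rhobar p) ∈ Fset p (rhobar p) := by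
  have hmem : rhobar p ∈ {ρ | (Fset p ρ).Nonempty} := Nat.sInf_mem ⟨ρ, hne⟩
  refine ⟨Nat.sInf_le hne, ?_⟩
  obtain ⟨u, hu⟩ := hmem
  obtain ⟨h1, h2⟩ := fmin_oSeq hu
  have hag : ∀ t : ℕ, rhobar p ≤ t → fmin p (rhobar p) t = p.eval t := fun t ht => fmin_of_le ht
  refine ⟨h1, h2, hag, ?_⟩
  have hex : ∃ ρ', ∀ t : ℕ, ρ' ≤ t → fmin p (rhobar p) t = p.eval t := ⟨_, hag⟩
  intro ρ' h'
  have hreg : IsRegOf p (fmin p (rhobar p)) (Nat.find hex) :=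
    ⟨Nat.find_spec hex, fun _ h => Nat.find_min' hex h⟩
  have hle : rhobar p ≤ Nat.find hex := Nat.sInf_le ⟨_, h1, h2, hreg⟩
  exact hle.trans (Nat.find_min' hex h')

theorem mRho_eq (hu : u ∈ Fset p ρ) (h : ∀ u' ∈ Fset p ρ, mReg u ≤ mReg u') :
    mRho p ρ = mReg u := by
  refine le_antisymm (Nat.sInf_le ⟨u, hu, rfl⟩) (le_csInf ⟨_, u, hu, rfl⟩ ?_)
  rintro r ⟨u', hu', rfl⟩
  exact h u' hu'

end HilbertFunction

/-- Corollary `cor:finale innesto`.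
Let `ρ` be an integer with `F(p,ρ) ≠ ∅`, and set `m̄ = m_{f^{ρ̄_p}_p}`. Then
`m^ρ_p = m̄` if `ρ̄_p ≤ ρ ≤ m̄ - 2`; `m^ρ_p = m_{f^ρ_p} = ρ+1` if `ρ ≥ m̄ - 1` and `f^ρ_p`
has regularity `ρ`; and `m^ρ_p = m_{g^ρ_p} = ρ+2` otherwise (i.e. if `ρ ≥ m̄ - 1` and
`f^ρ_p` has regularity strictly less than `ρ`). -/
theorem statement18 (p : GotzmannPoly) (hr : 1 < p.r) (ρ : ℕ)
    (hne : (Fset p ρ).Nonempty) :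
    (rhobar p ≤ ρ → ρ ≤ mReg (fmin p (rhobar p)) - 2 →
      mRho p ρ = mReg (fmin p (rhobar p))) ∧
    (mReg (fmin p (rhobar p)) - 1 ≤ ρ → IsRegOf p (fmin p ρ) ρ →
      mRho p ρ = mReg (fmin p ρ) ∧ mReg (fmin p ρ) = ρ + 1) ∧
    (mReg (fmin p (rhobar p)) - 1 ≤ ρ → ¬ IsRegOf p (fmin p ρ) ρ →
      mRho p ρ = mReg (gmin p ρ) ∧ mReg (gmin p ρ) = ρ + 2) := by
  obtain ⟨hle, hf⟩ := fmin_rhobar_mem hne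
  have hlow := lt_mReg hr hf
  refine ⟨fun _ hρ => ?_, fun hρ hreg => ?_, fun hρ hreg => ?_⟩
  · have heq : ∀ u ∈ Fset p ρ, mReg u = mReg (fmin p (rhobar p)) := by
      intro u hu
      have hlow' := lt_mReg hr hu
      refine le_antisymm ?_ ?_
      · obtain ⟨S, hS⟩ := Nat.exists_eq_add_of_le' (show 1 ≤ mReg (fmin p (rhobar p)) by omega)
        rw [hS]
        refine mReg_le_succ hr hu hf hS.le (by omega) fun k hk => (hu.2.2.1 k (by omega)).le
      · obtain ⟨S, hS⟩ := Nat.exists_eq_add_of_le' (show 1 ≤ mReg u by omega)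
        rw [hS]
        refine mReg_le_succ hr hf hu hS.le (by omega) fun k hk => ?_
        rcases Nat.lt_or_ge k (rhobar p) with hlt | hge
        · obtain rfl : ρ = k + 1 := by omega
          have hk' : rhobar p = k + 1 := by omega
          rw [hk']
          exact (fmin_le_of_mem hu).trans (le_eval_of_mReg hr hu (by omega))
        · exact (fmin_of_le hge).le
    obtain ⟨u, hu⟩ := hne
    rw [mRho_eq hu fun u' hu' => (heq u hu).trans_le (heq u' hu').ge, heq u hu]
  · obtain ⟨u, hu⟩ := hne
    have hmem : fmin p ρ ∈ Fset p ρ := ⟨(fmin_oSeq hu).1, (fmin_oSeq hu).2, hreg⟩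
    have hm : mReg (fmin p ρ) = ρ + 1 := by
      refine le_antisymm (mReg_le_succ hr hmem hf (by omega) le_rfl ?_) (lt_mReg hr hmem)
      rintro k rfl
      rcases Nat.lt_or_ge k (rhobar p) with hlt | hge
      · have hk : rhobar p = k + 1 := by omega
        rw [hk] at hρ hlow
        exact le_eval_of_mReg hr hmem (by omega)
      · have h1 := hf.1.minusMinus_le k
        rw [fmin_of_le (t := k) hge, fmin_of_le (t := k + 1) (by omega)] at h1
        rwa [fmin_of_lt (Nat.lt_succ_self k), fmin_of_le le_rfl]
    exact ⟨mRho_eq hmem fun u' hu' => hm.trans_le (lt_mReg hr hu'), hm⟩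
  · rcases ρ with _ | k
    · exact absurd ⟨fun t ht => fmin_of_le ht, fun _ _ => Nat.zero_le _⟩ hreg
    obtain ⟨u, hu⟩ := hne
    have hfk : fmin p (k + 1) k = p.eval k := by
      by_contra hne
      exact hreg (isRegOf_of_ne (fun t ht => fmin_of_le ht) hne)
    have hlow' : ∀ v ∈ Fset p (k + 1), k + 1 + 2 ≤ mReg v := by
      intro v hv
      have h1 := lt_mReg hr hv
      by_contra hlt
      have h2 := le_eval_of_mReg hr hv (by omega)
      have h3 := fmin_le_of_mem hv
      exact isRegOf_ne hv.2.2 (le_antisymm h2 (hfk ▸ h3))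
    have hg := gmin_mem hu hfk
    have hm : mReg (gmin p (k + 1)) = k + 1 + 2 :=
      le_antisymm (mReg_le_succ (S := k + 1 + 1) hr hg hf (by omega) (by omega) fun l hl =>
        (gmin_of_le (by omega)).le) (hlow' _ hg)
    exact ⟨mRho_eq hg fun u' hu' => hm.trans_le (hlow' u' hu'), hm⟩
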